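/- arXiv:1503.05133 — 9 statements merged into one kernel-verified Lean document; each statement's English description precedes it below -/
import Mathlib

section
/- Let α be a finite alphabet, let P be a probability distribution on α, and let P̄ be an n-type on α with supp(P̄) ⊆ supp(P). Let C be a nonempty subset of the type class T^n(P̄) and let U be the uniform distribution on C, viewed as a distribution on α^n. Then D(U‖P^n) = D(U‖P̄^n) + n·D(P̄‖P) = n·H(P̄) − log₂|C| + n·D(P̄‖P). -/
/-- Entropy (base 2) of a distribution on a finite alphabet:
`H(P) = ∑_{a : P(a) > 0} −P(a)·log₂ P(a)`. -/
noncomputable def entH {α : Type*} [Fintype α] (P : α → ℝ) : ℝ :=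
  ∑ a, if 0 < P a then -(P a * Real.logb 2 (P a)) else 0

/-- Informational divergence (base 2):
`D(R‖S) = ∑_{x : R(x) > 0} R(x)·log₂(R(x)/S(x))`. -/
noncomputable def divD {α : Type*} [Fintype α] (R S : α → ℝ) : ℝ :=
  ∑ a, if 0 < R a then R a * Real.logb 2 (R a / S a) else 0

/-- `cnt c a = n_a(c)`, the number of occurrences of symbol `a` in the sequence `c`. -/
def cnt {α : Type*} [DecidableEq α] {n : ℕ} (c : Fin n → α) (a : α) : ℕ :=
  (Finset.univ.filter fun i => c i = a).card

/-- The type class `T^n(Q)`: sequences of length `n` whose empirical distribution equals `Q`. -/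
noncomputable def typeClass {α : Type*} [Fintype α] [DecidableEq α] (n : ℕ) (Q : α → ℝ) :
    Finset (Fin n → α) :=
  Finset.univ.filter fun c => ∀ a, (cnt c a : ℝ) / n = Q a

/-- The i.i.d. product distribution `P^n(a^n) = ∏_i P(a_i)` on `α^n`. -/
noncomputable def prodP {α : Type*} {n : ℕ} (P : α → ℝ) (c : Fin n → α) : ℝ :=
  ∏ i, P (c i)

/-- `Q` is an `n`-type: `n·Q(a)` is a (nonnegative) integer for every `a`. -/
def IsNType {α : Type*} (n : ℕ) (Q : α → ℝ) : Prop :=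
  ∀ a, ∃ k : ℕ, (n : ℝ) * Q a = k

theorem divD_uniform_aux {α : Type*} [Fintype α] [DecidableEq α] (n : ℕ) (hn : 0 < n)
    (Q Pbar : α → ℝ) (hsupp : ∀ a, 0 < Pbar a → 0 < Q a)
    (C : Finset (Fin n → α)) (hC : C ⊆ typeClass n Pbar) (hCne : C.Nonempty) :
    divD (fun c => if c ∈ C then ((C.card : ℝ))⁻¹ else 0) (prodP Q) =
      - Real.logb 2 (C.card : ℝ) - (n : ℝ) * ∑ a, Pbar a * Real.logb 2 (Q a) := by
  have hn' : (0 : ℝ) < n := by exact_mod_cast hn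
  have hc : (0 : ℝ) < C.card := by exact_mod_cast hCne.card_pos
  have key : ∀ c ∈ C, Real.logb 2 ((C.card : ℝ)⁻¹ / prodP Q c) =
      - Real.logb 2 (C.card : ℝ) - (n : ℝ) * ∑ a, Pbar a * Real.logb 2 (Q a) := by
    intro c hcC
    have ht : ∀ a, (cnt c a : ℝ) / n = Pbar a := by
      have := hC hcC
      simpa [typeClass] using this
    have hpos : ∀ i, 0 < Q (c i) := by
      intro i
      apply hsupp
      rw [← ht]
      apply div_pos _ hn'
      have : 0 < cnt c (c i) := Finset.card_pos.mpr ⟨i, by simp⟩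
      exact_mod_cast this
    have hprod : prodP Q c ≠ 0 := Finset.prod_ne_zero_iff.mpr fun i _ => (hpos i).ne'
    have hlog : Real.logb 2 (prodP Q c) = ∑ i, Real.logb 2 (Q (c i)) := by
      unfold prodP
      rw [Real.logb_prod]
      exact fun i _ => (hpos i).ne'
    rw [Real.logb_div (inv_ne_zero hc.ne') hprod, Real.logb_inv, hlog]
    congr 1
    rw [← Finset.sum_fiberwise Finset.univ c, Finset.mul_sum]
    refine Finset.sum_congr rfl fun a _ => ?_
    rw [Finset.sum_congr rfl (g := fun _ => Real.logb 2 (Q a))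
      (fun i hi => by rw [(Finset.mem_filter.mp hi).2])]
    rw [Finset.sum_const, nsmul_eq_mul, ← ht a]
    unfold cnt
    field_simp
  have hterm : ∀ c : Fin n → α,
      (if 0 < (if c ∈ C then ((C.card : ℝ))⁻¹ else 0) then
        (if c ∈ C then ((C.card : ℝ))⁻¹ else 0) *
          Real.logb 2 ((if c ∈ C then ((C.card : ℝ))⁻¹ else 0) / prodP Q c) else 0) =
      if c ∈ C then (C.card : ℝ)⁻¹ *
        (- Real.logb 2 (C.card : ℝ) - (n : ℝ) * ∑ a, Pbar a * Real.logb 2 (Q a)) else 0 := by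
    intro c
    by_cases h : c ∈ C
    · simp only [h, if_true, inv_pos, hc, key c h]
    · simp [h]
  unfold divD
  rw [Finset.sum_congr rfl fun c _ => hterm c, Finset.sum_ite_mem, Finset.univ_inter,
    Finset.sum_const, nsmul_eq_mul]
  field_simp

/-- For a nonempty constant composition code `C ⊆ T^n(P̄)` with `supp(P̄) ⊆ supp(P)` and `U`
uniform on `C`: `D(U‖P^n) = D(U‖P̄^n) + n·D(P̄‖P) = n·H(P̄) − log₂|C| + n·D(P̄‖P)`. -/
theorem stmt2 {α : Type*} [Fintype α] [DecidableEq α] (n : ℕ) (hn : 0 < n)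
    (P Pbar : α → ℝ)
    (hP0 : ∀ a, 0 ≤ P a) (hP1 : ∑ a, P a = 1)
    (h0 : ∀ a, 0 ≤ Pbar a) (h1 : ∑ a, Pbar a = 1)
    (htype : IsNType n Pbar) (hsupp : ∀ a, 0 < Pbar a → 0 < P a)
    (C : Finset (Fin n → α)) (hC : C ⊆ typeClass n Pbar) (hCne : C.Nonempty) :
    divD (fun c => if c ∈ C then ((C.card : ℝ))⁻¹ else 0) (prodP P) =
      divD (fun c => if c ∈ C then ((C.card : ℝ))⁻¹ else 0) (prodP Pbar)
        + (n : ℝ) * divD Pbar P ∧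
    divD (fun c => if c ∈ C then ((C.card : ℝ))⁻¹ else 0) (prodP P) =
      (n : ℝ) * entH Pbar - Real.logb 2 (C.card : ℝ) + (n : ℝ) * divD Pbar P := by
  have hH : entH Pbar = - ∑ a, Pbar a * Real.logb 2 (Pbar a) := by
    unfold entH
    rw [← Finset.sum_neg_distrib]
    refine Finset.sum_congr rfl fun a _ => ?_
    rcases (h0 a).eq_or_lt with h | h
    · simp [← h]
    · simp [h]
  have hD : divD Pbar P = ∑ a, Pbar a * Real.logb 2 (Pbar a) -
      ∑ a, Pbar a * Real.logb 2 (P a) := by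
    unfold divD
    rw [← Finset.sum_sub_distrib]
    refine Finset.sum_congr rfl fun a _ => ?_
    rcases (h0 a).eq_or_lt with h | h
    · simp [← h]
    · rw [if_pos h, Real.logb_div h.ne' (hsupp a h).ne', mul_sub]
  rw [divD_uniform_aux n hn P Pbar hsupp C hC hCne,
    divD_uniform_aux n hn Pbar Pbar (fun _ h => h) C hC hCne, hH, hD]
  constructor <;> ring
end

section
/- Let α be a finite alphabet with |α| = k, and let P be a probability distribution on α with full support (P(a) > 0 for all a). Then for every positive integer n there exists an n-type P̄ on α with supp(P̄) ⊆ supp(P) such that D(P̄‖P) < k / (n² · min_{a∈α} P(a)). -/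
theorem aux_round {α : Type*} [Fintype α] [Nonempty α] (p : α → ℝ) (n : ℕ)
    (h0 : ∀ a, 0 < p a) (h1 : ∑ a, p a = n) :
    ∃ r : α → ℕ, ∑ a, r a = n ∧ ∑ a, ((r a : ℝ) - p a) ^ 2 ≤ (Fintype.card α : ℝ) / 4 := by
  classical
  have hne : (Finset.piAntidiag (Finset.univ : Finset α) n).Nonempty := by
    refine ⟨Pi.single (Classical.arbitrary α) n, ?_⟩
    simp [Finset.mem_piAntidiag]
  obtain ⟨r, hr, hmin⟩ := Finset.exists_min_image _
    (fun r : α → ℕ => ∑ a, ((r a : ℝ) - p a) ^ 2) hne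
  have hrs : ∑ a, r a = n := by simpa [Finset.mem_piAntidiag] using hr
  refine ⟨r, hrs, ?_⟩
  have hes : ∑ a, ((r a : ℝ) - p a) = 0 := by
    rw [Finset.sum_sub_distrib, h1, ← hrs]; push_cast; ring
  obtain ⟨a, -, ha⟩ := Finset.exists_max_image Finset.univ
    (fun a => (r a : ℝ) - p a) Finset.univ_nonempty
  set M := (r a : ℝ) - p a with hM
  have hlow : ∀ b, M - 1 ≤ (r b : ℝ) - p b := by
    intro b
    by_cases hab : b = a
    · subst hab; linarith
    by_cases hM0 : M ≤ 0
    · have hz : ∑ a, ((r a : ℝ) - p a) ≤ (r b : ℝ) - p b := by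
        rw [← Finset.add_sum_erase _ _ (Finset.mem_univ b)]
        have : ∑ x ∈ Finset.univ.erase b, ((r x : ℝ) - p x) ≤ 0 :=
          Finset.sum_nonpos fun x _ => (ha x (Finset.mem_univ x)).trans hM0
        linarith
      linarith
    · have hra : 1 ≤ r a := by
        by_contra hc
        have : r a = 0 := by omega
        have h2 := h0 a
        rw [this] at hM
        push_cast at hM
        linarith
      let r' : α → ℕ := Function.update (Function.update r a (r a - 1)) b (r b + 1)
      have key : ∀ (g : α → ℕ → ℝ), ∑ x, g x (r' x) =
          ∑ x, g x (r x) + (g a (r a - 1) - g a (r a)) + (g b (r b + 1) - g b (r b)) := by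
        intro g
        have hba : a ∈ Finset.univ.erase b := by simp [Ne.symm hab]
        rw [← Finset.add_sum_erase _ _ (Finset.mem_univ b),
          ← Finset.add_sum_erase _ (fun x => g x (r x)) (Finset.mem_univ b),
          ← Finset.add_sum_erase _ _ hba, ← Finset.add_sum_erase _ (fun x => g x (r x)) hba]
        have e : ∑ x ∈ (Finset.univ.erase b).erase a, g x (r' x)
            = ∑ x ∈ (Finset.univ.erase b).erase a, g x (r x) := by
          refine Finset.sum_congr rfl fun x hx => ?_
          simp only [Finset.mem_erase] at hx
          simp [r', hx.1, hx.2.1]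
        rw [e]
        simp [r', Ne.symm hab]
        ring
      have hs : ∑ x, r' x = n := by
        have := key (fun _ m => (m : ℝ))
        push_cast [Nat.cast_sub hra] at this
        have h3 : ((∑ x, r' x : ℕ) : ℝ) = ((∑ x, r x : ℕ) : ℝ) := by
          push_cast; rw [this]; ring
        rw [hrs] at h3
        exact_mod_cast h3
      have h4 := hmin r' (by simp [Finset.mem_piAntidiag, hs])
      have h5 := key (fun x m => ((m : ℝ) - p x) ^ 2)
      rw [h5] at h4
      push_cast [Nat.cast_sub hra] at h4
      nlinarith
  have hq : ∑ b, (((r b : ℝ) - p b) ^ 2) ≤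
      ∑ b, ((2 * M - 1) * ((r b : ℝ) - p b) + M * (1 - M)) := by
    refine Finset.sum_le_sum fun b hb => ?_
    have := hlow b
    have h6 : (r b : ℝ) - p b ≤ M := ha b hb
    nlinarith [mul_nonneg (sub_nonneg.2 this) (sub_nonneg.2 h6)]
  rw [Finset.sum_add_distrib, ← Finset.mul_sum, hes, Finset.sum_const, Finset.card_univ,
    nsmul_eq_mul] at hq
  have hk : (0 : ℝ) ≤ Fintype.card α := Nat.cast_nonneg _
  nlinarith [mul_nonneg hk (sq_nonneg (M - 1 / 2))]

/-- For a full-support distribution `P` on an alphabet of size `k` and every positive `n`,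
there is an `n`-type `P̄` with `supp(P̄) ⊆ supp(P)` and
`D(P̄‖P) < k / (n² · min_a P(a))`. -/
theorem stmt3 {α : Type*} [Fintype α] [Nonempty α] (P : α → ℝ)
    (h0 : ∀ a, 0 < P a) (h1 : ∑ a, P a = 1) (n : ℕ) (hn : 0 < n) :
    ∃ Pbar : α → ℝ, (∀ a, 0 ≤ Pbar a) ∧ (∑ a, Pbar a = 1) ∧ IsNType n Pbar ∧
      (∀ a, 0 < Pbar a → 0 < P a) ∧
      divD Pbar P <
        (Fintype.card α : ℝ) /
          ((n : ℝ) ^ 2 * Finset.univ.inf' Finset.univ_nonempty P) := by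
  have hn' : (0 : ℝ) < n := by exact_mod_cast hn
  obtain ⟨r, hr, he⟩ := aux_round (fun a => (n : ℝ) * P a) n
    (fun a => mul_pos hn' (h0 a)) (by rw [← Finset.mul_sum, h1, mul_one])
  have hsum : ∑ a, (r a : ℝ) / n = 1 := by
    rw [← Finset.sum_div, ← Nat.cast_sum, hr, div_self hn'.ne']
  refine ⟨fun a => (r a : ℝ) / n, fun a => by positivity, hsum,
    fun a => ⟨r a, by field_simp⟩, fun a _ => h0 a, ?_⟩
  set m := Finset.univ.inf' Finset.univ_nonempty P with hm
  have hmP : ∀ a, m ≤ P a := fun a => Finset.inf'_le _ (Finset.mem_univ a)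
  have hm0 : 0 < m := by
    rw [hm, Finset.lt_inf'_iff]
    exact fun a _ => h0 a
  have hk : (0 : ℝ) < Fintype.card α := by exact_mod_cast Fintype.card_pos
  have hl := Real.log_two_gt_d9
  have hl0 : 0 < Real.log 2 := by linarith
  have hB : 0 < (Fintype.card α : ℝ) / ((n : ℝ) ^ 2 * m) := by positivity
  have hmain : divD (fun a => (r a : ℝ) / n) P * Real.log 2 ≤
      ∑ a, (((r a : ℝ) - n * P a) ^ 2 / ((n : ℝ) ^ 2 * m) + ((r a : ℝ) / n - P a)) := by
    unfold divD
    rw [Finset.sum_mul]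
    refine Finset.sum_le_sum fun a _ => ?_
    have hP := h0 a
    have hc : ((r a : ℝ) / n - P a) ^ 2 / P a ≤ ((r a : ℝ) - n * P a) ^ 2 / ((n : ℝ) ^ 2 * m) := by
      have e1 : ((r a : ℝ) / n - P a) ^ 2 / P a
          = ((r a : ℝ) - n * P a) ^ 2 / ((n : ℝ) ^ 2 * P a) := by
        field_simp
      rw [e1]
      have := hmP a
      gcongr
    have e2 : ((r a : ℝ) / n - P a) ^ 2 / P a + ((r a : ℝ) / n - P a)
        = (r a : ℝ) / n * ((r a : ℝ) / n / P a - 1) := by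
      field_simp
      ring
    refine le_trans ?_ (add_le_add_left hc _)
    rw [e2]
    split_ifs with hR
    · rw [Real.logb, mul_assoc, div_mul_cancel₀ _ hl0.ne']
      exact mul_le_mul_of_nonneg_left (Real.log_le_sub_one_of_pos (div_pos hR hP)) hR.le
    · have : (r a : ℝ) / n = 0 := le_antisymm (not_lt.1 hR) (by positivity)
      rw [this]; simp
  rw [Finset.sum_add_distrib, Finset.sum_sub_distrib, hsum, h1, ← Finset.sum_div, sub_self,
    add_zero] at hmain
  have h7 : (∑ a, ((r a : ℝ) - n * P a) ^ 2) / ((n : ℝ) ^ 2 * m) ≤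
      (Fintype.card α : ℝ) / 4 / ((n : ℝ) ^ 2 * m) := by gcongr
  have h8 : (Fintype.card α : ℝ) / 4 / ((n : ℝ) ^ 2 * m)
      = (Fintype.card α : ℝ) / ((n : ℝ) ^ 2 * m) / 4 := by ring
  rw [h8] at h7
  by_contra hcon
  have := mul_le_mul_of_nonneg_right (not_lt.1 hcon) hl0.le
  nlinarith
end

section
/- Let α be a finite alphabet with |α| = k and let P̄ be an n-type on α. Then the size of the type class satisfies |T^n(P̄)| ≥ C(n+k−1, k−1)^{−1} · 2^{n·H(P̄)} ≥ (n+k)^{−k} · 2^{n·H(P̄)}, where C(·,·) denotes the binomial coefficient. -/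
open scoped Nat in
lemma aux_fact (f k : ℕ) : f ! * f ^ k ≤ k ! * f ^ f := by
  rcases le_total f k with h | h
  · obtain ⟨d, rfl⟩ := Nat.exists_eq_add_of_le h
    have h1 : f ! * f ^ d ≤ (f + d)! :=
      le_trans (Nat.mul_le_mul_left _ (Nat.pow_le_pow_left (Nat.le_succ f) d))
        Nat.factorial_mul_pow_le_factorial
    calc f ! * f ^ (f + d) = (f ! * f ^ d) * f ^ f := by ring
      _ ≤ _ := Nat.mul_le_mul_right _ h1
  · obtain ⟨d, rfl⟩ := Nat.exists_eq_add_of_le h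
    have h1 : ∀ e, (k + e)! ≤ k ! * (k + e) ^ e := by
      intro e
      induction e with
      | zero => simp
      | succ e ih =>
        rw [← add_assoc, Nat.factorial_succ, pow_succ]
        have : (k + e) ^ e ≤ (k + e + 1) ^ e := Nat.pow_le_pow_left (Nat.le_succ _) e
        calc (k + e + 1) * (k + e)! ≤ (k + e + 1) * (k ! * (k + e + 1) ^ e) :=
              Nat.mul_le_mul_left _ (ih.trans (Nat.mul_le_mul_left _ this))
          _ = _ := by ring
    calc (k + d)! * (k + d) ^ k ≤ (k ! * (k + d) ^ d) * (k + d) ^ k :=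
          Nat.mul_le_mul_right _ (h1 d)
      _ = k ! * (k + d) ^ (k + d) := by ring

lemma aux_term {α : Type*} [Fintype α] (f k : α → ℕ) (h : ∑ a, f a = ∑ a, k a) :
    Nat.multinomial Finset.univ k * ∏ a, f a ^ k a ≤
      Nat.multinomial Finset.univ f * ∏ a, f a ^ f a := by
  have h1 := Nat.multinomial_spec Finset.univ k
  have h2 := Nat.multinomial_spec Finset.univ f
  rw [h, ← h1] at h2
  have h3 : (∏ a, (f a).factorial) * ∏ a, f a ^ k a ≤
      (∏ a, (k a).factorial) * ∏ a, f a ^ f a := by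
    rw [← Finset.prod_mul_distrib, ← Finset.prod_mul_distrib]
    exact Finset.prod_le_prod' fun a _ => aux_fact _ _
  have p1 : 0 < ∏ a, (k a).factorial := Finset.prod_pos fun a _ => Nat.factorial_pos _
  refine Nat.le_of_mul_le_mul_left ?_ p1
  calc _ = ((∏ a, (k a).factorial) * Nat.multinomial Finset.univ k) * ∏ a, f a ^ k a := by ring
    _ = Nat.multinomial Finset.univ f * ((∏ a, (f a).factorial) * ∏ a, f a ^ k a) := by
      rw [← h2]; ring
    _ ≤ Nat.multinomial Finset.univ f * ((∏ a, (k a).factorial) * ∏ a, f a ^ f a) :=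
      Nat.mul_le_mul_left _ h3
    _ = _ := by ring

lemma aux_card {α : Type*} [Fintype α] [DecidableEq α] (n : ℕ) :
    (Finset.piAntidiag (Finset.univ : Finset α) n).card
      = (Fintype.card α + n - 1).choose n := by
  rw [← Finset.map_sym_eq_piAntidiag, Finset.card_map, Finset.sym_univ, Finset.card_univ,
    Sym.card_sym_eq_choose]

lemma aux_main {α : Type*} [Fintype α] [DecidableEq α] (n : ℕ) (f : α → ℕ)
    (h : ∑ a, f a = n) :
    n ^ n ≤ (Fintype.card α + n - 1).choose n *
      (Nat.multinomial Finset.univ f * ∏ a, f a ^ f a) := by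
  have := Finset.sum_pow_eq_sum_piAntidiag (Finset.univ : Finset α) f n
  rw [h] at this
  rw [this, ← aux_card, ← smul_eq_mul]
  refine Finset.sum_le_card_nsmul _ _ _ fun k hk => ?_
  rw [Finset.mem_piAntidiag] at hk
  exact aux_term f k (h.trans hk.1.symm)

lemma aux_count {α : Type*} [Fintype α] [DecidableEq α] (n : ℕ) (f : α → ℕ)
    (h : ∑ a, f a = n) :
    (Finset.univ.filter fun c : Fin n → α => ∀ a, cnt c a = f a).card
      = Nat.multinomial Finset.univ f := by
  have h1 := Finset.sum_pow_eq_sum_piAntidiag (Finset.univ : Finset α)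
    (fun a => (MvPolynomial.X a : MvPolynomial α ℕ)) n
  rw [Finset.sum_pow'] at h1
  have key : ∀ k : α → ℕ, (∏ a, (MvPolynomial.X a : MvPolynomial α ℕ) ^ k a)
      = MvPolynomial.monomial (Finsupp.equivFunOnFinite.symm k) 1 := by
    intro k
    rw [MvPolynomial.monomial_eq, Finsupp.prod_fintype _ _ (by simp)]
    simp
  have key2 : ∀ c : Fin n → α, (∏ i, (MvPolynomial.X (c i) : MvPolynomial α ℕ))
      = ∏ a, (MvPolynomial.X a : MvPolynomial α ℕ) ^ cnt c a := by
    intro c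
    rw [← Finset.prod_fiberwise_of_maps_to (t := Finset.univ) (g := c) (by simp)]
    refine Finset.prod_congr rfl fun a _ => ?_
    rw [cnt, ← Finset.prod_const]
    refine Finset.prod_congr rfl fun i hi => ?_
    rw [(Finset.mem_filter.1 hi).2]
  have h2 := congrArg (MvPolynomial.coeff (Finsupp.equivFunOnFinite.symm f)) h1
  simp only [key2, key, MvPolynomial.coeff_sum, MvPolynomial.coeff_monomial,
    EmbeddingLike.apply_eq_iff_eq, ← MvPolynomial.C_eq_coe_nat, MvPolynomial.coeff_C_mul] at h2
  simp [funext_iff] at h2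
  refine h2.trans ?_
  rw [Finset.sum_eq_single f]
  · simp
  · intro b _ hb
    rw [if_neg]
    exact fun hh => hb (funext hh)
  · intro hh
    exact absurd (by simp [h]) hh

/-- Size of the type class (lower bound, [Csiszár–Körner, Lemma 2.2]):
`|T^n(P̄)| ≥ C(n+k−1, k−1)⁻¹ · 2^{n·H(P̄)} ≥ (n+k)^{−k} · 2^{n·H(P̄)}`. -/
theorem stmt4 {α : Type*} [Fintype α] [DecidableEq α] (n : ℕ) (hn : 0 < n)
    (Pbar : α → ℝ) (h0 : ∀ a, 0 ≤ Pbar a) (h1 : ∑ a, Pbar a = 1)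
    (htype : IsNType n Pbar) :
    (((typeClass n Pbar).card : ℝ) ≥
      ((n + Fintype.card α - 1).choose (Fintype.card α - 1) : ℝ)⁻¹ *
        (2 : ℝ) ^ ((n : ℝ) * entH Pbar)) ∧
    (((n + Fintype.card α - 1).choose (Fintype.card α - 1) : ℝ)⁻¹ *
        (2 : ℝ) ^ ((n : ℝ) * entH Pbar) ≥
      ((n : ℝ) + Fintype.card α) ^ (-(Fintype.card α : ℝ)) *
        (2 : ℝ) ^ ((n : ℝ) * entH Pbar)) := by

  choose f hf using htype
  have hnR : (0 : ℝ) < n := by exact_mod_cast hn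
  have hP : ∀ a, Pbar a = f a / n := fun a => by
    rw [← hf a]; field_simp
  have hsum : ∑ a, f a = n := by
    have : (∑ a, (f a : ℝ)) = n := by
      simp only [← hf]
      rw [← Finset.mul_sum, h1, mul_one]
    exact_mod_cast this
  have hk : 0 < Fintype.card α := by
    rw [Fintype.card_pos_iff]
    by_contra hne
    rw [not_nonempty_iff] at hne
    simp at h1
  obtain ⟨m, hm⟩ : ∃ m, Fintype.card α = m + 1 := ⟨_, (Nat.succ_pred_eq_of_pos hk).symm⟩
  have hT : (typeClass n Pbar).card = Nat.multinomial Finset.univ f := by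
    rw [← aux_count n f hsum, typeClass]
    congr 1
    ext c
    simp only [Finset.mem_filter, Finset.mem_univ, true_and]
    refine forall_congr' fun a => ?_
    rw [hP a, div_left_inj' hnR.ne', Nat.cast_inj]
  have hch : (n + Fintype.card α - 1).choose (Fintype.card α - 1)
      = (Fintype.card α + n - 1).choose n := by
    rw [hm]
    have e1 : n + (m + 1) - 1 = m + n := by omega
    have e2 : m + 1 + n - 1 = m + n := by omega
    rw [e1, e2, Nat.add_sub_cancel, Nat.choose_symm_add]
  have hpos : (0 : ℝ) < ((n + Fintype.card α - 1).choose (Fintype.card α - 1) : ℝ) := by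
    exact_mod_cast Nat.choose_pos (by omega)
  have hent : (2 : ℝ) ^ ((n : ℝ) * entH Pbar) * ∏ a, (f a : ℝ) ^ f a = (n : ℝ) ^ n := by
    rw [entH, Finset.mul_sum, Real.rpow_sum_of_pos (by norm_num), ← Finset.prod_mul_distrib]
    have : ∀ a ∈ (Finset.univ : Finset α), (2 : ℝ) ^ ((n : ℝ) *
        (if 0 < Pbar a then -(Pbar a * Real.logb 2 (Pbar a)) else 0)) * (f a : ℝ) ^ f a
        = (n : ℝ) ^ f a := by
      intro a _
      split_ifs with hp
      · have hfa : (0 : ℝ) < f a := by rw [← hf a]; positivity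
        have e : (n : ℝ) * -(Pbar a * Real.logb 2 (Pbar a))
            = Real.logb 2 (Pbar a) * (-(f a : ℝ)) := by rw [← hf a]; ring
        rw [e, Real.rpow_mul (by norm_num), Real.rpow_logb (by norm_num) (by norm_num) hp,
          Real.rpow_neg hp.le, Real.rpow_natCast, hP a, div_pow]
        field_simp
      · have h00 : Pbar a = 0 := le_antisymm (not_lt.1 hp) (h0 a)
        have : f a = 0 := by
          have := hf a
          rw [h00, mul_zero] at this
          exact_mod_cast this.symm
        simp [this]
    rw [Finset.prod_congr rfl this, Finset.prod_pow_eq_pow_sum, hsum]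
  have hprod : (0 : ℝ) < ∏ a, (f a : ℝ) ^ f a := by
    have : 0 < ∏ a, f a ^ f a := Finset.prod_pos fun a _ => by
      rcases Nat.eq_zero_or_pos (f a) with h | h
      · simp [h]
      · positivity
    exact_mod_cast this
  constructor
  · rw [ge_iff_le, inv_mul_le_iff₀ hpos]
    refine le_of_mul_le_mul_right ?_ hprod
    rw [hent, hT, hch, mul_assoc]
    exact_mod_cast aux_main n f hsum
  · rw [ge_iff_le]
    refine mul_le_mul_of_nonneg_right ?_ (by positivity)
    rw [Real.rpow_neg (by positivity), Real.rpow_natCast]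
    refine inv_anti₀ hpos ?_
    have h2 : (n + Fintype.card α - 1).choose (Fintype.card α - 1)
        ≤ (n + Fintype.card α) ^ Fintype.card α :=
      calc _ ≤ (n + Fintype.card α - 1) ^ (Fintype.card α - 1) := Nat.choose_le_pow _ _
        _ ≤ (n + Fintype.card α) ^ (Fintype.card α - 1) :=
          Nat.pow_le_pow_left (Nat.sub_le _ _) _
        _ ≤ _ := Nat.pow_le_pow_right (by omega) (Nat.sub_le _ _)
    exact_mod_cast h2
end

section
/- Let α be a finite alphabet and let P̄ be an n-type on α. Then the size of the type class satisfies |T^n(P̄)| ≤ 2^{n·H(P̄)}. -/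
/-- Size of the type class (upper bound): `|T^n(P̄)| ≤ 2^{n·H(P̄)}`. -/
theorem stmt5 {α : Type*} [Fintype α] [DecidableEq α] (n : ℕ) (hn : 0 < n)
    (Pbar : α → ℝ) (h0 : ∀ a, 0 ≤ Pbar a) (h1 : ∑ a, Pbar a = 1)
    (htype : IsNType n Pbar) :
    ((typeClass n Pbar).card : ℝ) ≤ (2 : ℝ) ^ ((n : ℝ) * entH Pbar) := by
  have hnR : (0 : ℝ) < n := by exact_mod_cast hn
  have hsum : ∑ c : Fin n → α, ∏ i, Pbar (c i) = 1 := by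
    have h := Finset.prod_univ_sum (fun _ : Fin n => (Finset.univ : Finset α)) (fun _ a => Pbar a)
    simp only [h1, Finset.prod_const_one, Fintype.piFinset_univ] at h
    exact h.symm
  have key : ∀ c ∈ typeClass n Pbar,
      ∏ i, Pbar (c i) = (2 : ℝ) ^ (-((n : ℝ) * entH Pbar)) := by
    intro c hc
    have hc' : ∀ a, (cnt c a : ℝ) / n = Pbar a := by
      simpa [typeClass] using hc
    have e1 : ∏ i, Pbar (c i) = ∏ a, Pbar a ^ cnt c a := by
      rw [← Finset.prod_fiberwise Finset.univ c (fun i => Pbar (c i))]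
      refine Finset.prod_congr rfl fun a _ => ?_
      rw [cnt, ← Finset.prod_const]
      refine Finset.prod_congr rfl fun i hi => ?_
      rw [(Finset.mem_filter.mp hi).2]
    rw [e1, entH, Finset.mul_sum, ← Finset.sum_neg_distrib,
      Real.rpow_sum_of_pos (by norm_num)]
    refine Finset.prod_congr rfl fun a _ => ?_
    have hcnt : (cnt c a : ℝ) = n * Pbar a := by
      rw [← hc' a]; field_simp
    split_ifs with hp
    · have e2 : -((n : ℝ) * -(Pbar a * Real.logb 2 (Pbar a)))
          = Real.logb 2 (Pbar a) * (cnt c a : ℝ) := by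
        rw [hcnt]; ring
      rw [e2, Real.rpow_mul (by norm_num), Real.rpow_logb (by norm_num) (by norm_num) hp,
        Real.rpow_natCast]
    · have hz : Pbar a = 0 := le_antisymm (not_lt.mp hp) (h0 a)
      have : cnt c a = 0 := by
        rw [hz, mul_zero] at hcnt
        exact_mod_cast hcnt
      simp [this]
  have hle : ∑ c ∈ typeClass n Pbar, ∏ i, Pbar (c i) ≤ 1 := by
    rw [← hsum]
    exact Finset.sum_le_sum_of_subset_of_nonneg (Finset.subset_univ _)
      fun c _ _ => Finset.prod_nonneg fun i _ => h0 _
  rw [Finset.sum_congr rfl key, Finset.sum_const, nsmul_eq_mul,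
    Real.rpow_neg (by norm_num), ← div_eq_mul_inv,
    div_le_one (Real.rpow_pos_of_pos (by norm_num) _)] at hle
  exact hle
end

section
/- Let α be a finite alphabet with |α| = k, let P̄ be an n-type on α, and set m = ⌊log₂|T^n(P̄)|⌋. Then the matching rate satisfies m/n ≥ H(P̄) − k·log₂(n+k)/n − 1/n. -/
open Nat in
theorem fact_pow_aux (K L : ℕ) : K ! * K ^ L ≤ L ! * K ^ K := by
  rcases le_total K L with h | h
  · calc K ! * K ^ L = (K ! * K ^ (L - K)) * K ^ K := by
          rw [mul_assoc, ← pow_add, Nat.sub_add_cancel h]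
      _ ≤ L ! * K ^ K := Nat.mul_le_mul_right _ (Nat.factorial_mul_pow_sub_le_factorial h)
  · have h2 : K ! ≤ L ! * K ^ (K - L) := by
      have h3 := Nat.factorial_mul_descFactorial (n := K) (k := K - L) (Nat.sub_le _ _)
      rw [Nat.sub_sub_self h] at h3
      rw [← h3]
      exact Nat.mul_le_mul_left _ (Nat.descFactorial_le_pow _ _)
    calc K ! * K ^ L ≤ (L ! * K ^ (K - L)) * K ^ L := Nat.mul_le_mul_right _ h2
      _ = L ! * K ^ K := by rw [mul_assoc, ← pow_add, Nat.sub_add_cancel h]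

open Nat in
theorem multinomial_max {α : Type*} [Fintype α] [DecidableEq α] (K L : α → ℕ)
    (h : ∑ a, L a = ∑ a, K a) :
    Nat.multinomial Finset.univ L * ∏ a, K a ^ L a
      ≤ Nat.multinomial Finset.univ K * ∏ a, K a ^ K a := by
  have hL := Nat.multinomial_spec Finset.univ L
  have hK := Nat.multinomial_spec Finset.univ K
  have h1 : (∏ a, (K a)!) * ∏ a, K a ^ L a ≤ (∏ a, (L a)!) * ∏ a, K a ^ K a := by
    rw [← Finset.prod_mul_distrib, ← Finset.prod_mul_distrib]
    exact Finset.prod_le_prod' fun a _ => fact_pow_aux _ _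
  have pL : 0 < ∏ a, (L a)! := Finset.prod_pos fun a _ => Nat.factorial_pos _
  have pK : 0 < ∏ a, (K a)! := Finset.prod_pos fun a _ => Nat.factorial_pos _
  rw [h, ← hK] at hL
  refine Nat.le_of_mul_le_mul_left ?_ (Nat.mul_pos pL pK)
  set A := ∏ a, (L a)!
  set B := ∏ a, (K a)!
  set X := ∏ a, K a ^ L a
  set Y := ∏ a, K a ^ K a
  set m := Nat.multinomial Finset.univ K
  set l := Nat.multinomial Finset.univ L
  calc A * B * (l * X) = (A * l) * (B * X) := by ring
    _ = (B * m) * (B * X) := by rw [hL]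
    _ ≤ (B * m) * (A * Y) := Nat.mul_le_mul_left _ h1
    _ = A * B * (m * Y) := by ring

theorem pow_le_multinomial {α : Type*} [Fintype α] [DecidableEq α] (n : ℕ) (K : α → ℕ)
    (h : ∑ a, K a = n) :
    n ^ n ≤ (n + 1) ^ Fintype.card α *
      (Nat.multinomial Finset.univ K * ∏ a, K a ^ K a) := by
  have e := Finset.sum_pow_eq_sum_piAntidiag Finset.univ K n
  rw [h] at e
  rw [e]
  simp only [Nat.cast_id]
  have hc : (Finset.piAntidiag (Finset.univ : Finset α) n).card ≤ (n + 1) ^ Fintype.card α := by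
    have : Finset.piAntidiag (Finset.univ : Finset α) n ⊆
        Fintype.piFinset (fun _ : α => Finset.range (n + 1)) := by
      intro f hf
      rw [Finset.mem_piAntidiag] at hf
      rw [Fintype.mem_piFinset]
      intro a
      rw [Finset.mem_range, Nat.lt_succ_iff, ← hf.1]
      exact Finset.single_le_sum (f := f) (fun _ _ => Nat.zero_le _) (Finset.mem_univ a)
    refine (Finset.card_le_card this).trans ?_
    simp [Fintype.card_piFinset]
  refine (Finset.sum_le_card_nsmul _ _ (Nat.multinomial Finset.univ K * ∏ a, K a ^ K a) ?_).trans ?_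
  · intro L hL
    rw [Finset.mem_piAntidiag] at hL
    exact multinomial_max K L (hL.1.trans h.symm)
  · rw [smul_eq_mul]
    exact Nat.mul_le_mul_right _ hc

open Nat in
theorem multinomial_le_card {α : Type*} [Fintype α] [DecidableEq α] (n : ℕ) (K : α → ℕ)
    (h : ∑ a, K a = n) :
    Nat.multinomial Finset.univ K ≤
      (Finset.univ.filter fun c : Fin n → α => ∀ a, cnt c a = K a).card := by
  have e : (Σ a, Fin (K a)) ≃ Fin n := Fintype.equivFinOfCardEq (by simp [h])
  let c : Fin n → α := fun i => (e.symm i).1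
  have hcard : ∀ a, Fintype.card {i // c i = a} = K a := by
    intro a
    have : {i // c i = a} ≃ Fin (K a) :=
      (e.symm.subtypeEquiv (p := fun i => c i = a) (q := fun x => x.1 = a) (fun i => Iff.rfl)).trans (Equiv.sigmaSubtype a)
    simpa using Fintype.card_congr this
  have key : (Finset.univ : Finset (Equiv.Perm (Fin n))).card ≤ (∏ a, (K a)!) *
      (Finset.univ.filter fun c : Fin n → α => ∀ a, cnt c a = K a).card := by
    apply Finset.card_le_mul_card_image_of_maps_to (f := fun σ : Equiv.Perm (Fin n) => c ∘ (σ : Fin n → Fin n))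
    · intro σ _
      rw [Finset.mem_filter]
      refine ⟨Finset.mem_univ _, fun a => ?_⟩
      rw [cnt, ← hcard a, ← Fintype.card_subtype]
      exact Fintype.card_congr (σ.subtypeEquiv (fun i => Iff.rfl))
    · intro b _
      rcases Finset.eq_empty_or_nonempty
        (Finset.univ.filter fun σ : Equiv.Perm (Fin n) => c ∘ (σ : Fin n → Fin n) = b) with h0 | ⟨τ, hτ⟩
      · rw [h0]; simp
      · have hs := DomMulAct.stabilizer_card c
        simp only [hcard] at hs
        rw [← hs, ← Fintype.card_subtype]
        rw [Finset.mem_filter] at hτ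
        refine Fintype.card_le_of_injective
          (fun σ => ⟨σ.1 * τ⁻¹, ?_⟩) ?_
        · have h1 := σ.2.trans hτ.2.symm
          funext i
          have := congrFun h1 (τ⁻¹ i)
          simpa using this
        · intro σ σ' hh
          simpa [Subtype.ext_iff] using hh
  rw [Finset.card_univ, Fintype.card_perm, Fintype.card_fin] at key
  have hK := Nat.multinomial_spec Finset.univ K
  rw [h] at hK
  rw [← hK] at key
  exact Nat.le_of_mul_le_mul_left key (Finset.prod_pos fun a _ => Nat.factorial_pos _)

/-- Lower bound on the ccdm matching rate: with `m = ⌊log₂|T^n(P̄)|⌋` and `k = |α|`,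
`m/n ≥ H(P̄) − k·log₂(n+k)/n − 1/n`. -/
theorem stmt6 {α : Type*} [Fintype α] [DecidableEq α] (n : ℕ) (hn : 0 < n)
    (Pbar : α → ℝ) (h0 : ∀ a, 0 ≤ Pbar a) (h1 : ∑ a, Pbar a = 1)
    (htype : IsNType n Pbar) :
    ((⌊Real.logb 2 ((typeClass n Pbar).card : ℝ)⌋ : ℝ) / n ≥
      entH Pbar
        - (Fintype.card α : ℝ) * Real.logb 2 ((n : ℝ) + Fintype.card α) / n
        - 1 / n) := by
  choose K hK using htype
  have hn' : (0 : ℝ) < n := by exact_mod_cast hn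
  have hsum : ∑ a, K a = n := by
    have : ((∑ a, K a : ℕ) : ℝ) = n := by
      push_cast
      simp_rw [← hK]
      rw [← Finset.mul_sum, h1, mul_one]
    exact_mod_cast this
  have hT : typeClass n Pbar =
      Finset.univ.filter fun c : Fin n → α => ∀ a, cnt c a = K a := by
    unfold typeClass
    ext c
    simp only [Finset.mem_filter, Finset.mem_univ, true_and]
    refine forall_congr' fun a => ?_
    rw [div_eq_iff hn'.ne', mul_comm, hK]
    exact Nat.cast_inj
  have hP : ∀ a, Pbar a = K a / n := fun a => by
    rw [eq_div_iff hn'.ne', mul_comm, hK]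
  have hm := multinomial_le_card n K hsum
  rw [← hT] at hm
  have hT0 : 0 < (typeClass n Pbar).card := (Nat.multinomial_pos _ _).trans_le hm
  have hk : 0 < Fintype.card α := by
    rw [Fintype.card_pos_iff]
    by_contra hne
    rw [not_nonempty_iff] at hne
    simp at h1
  have main : (n : ℝ) ^ n ≤ ((n : ℝ) + Fintype.card α) ^ Fintype.card α *
      ((typeClass n Pbar).card * ∏ a, (K a : ℝ) ^ K a) := by
    have : n ^ n ≤ (n + Fintype.card α) ^ Fintype.card α *
        ((typeClass n Pbar).card * ∏ a, K a ^ K a) :=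
      (pow_le_multinomial n K hsum).trans (Nat.mul_le_mul
        (Nat.pow_le_pow_left (by omega) _) (Nat.mul_le_mul_right _ hm))
    exact_mod_cast this
  have hKK : ∀ a, (K a : ℝ) ^ K a ≠ 0 := fun a => by
    rcases Nat.eq_zero_or_pos (K a) with h | h
    · simp [h]
    · positivity
  have hent : n * entH Pbar = n * Real.logb 2 n - ∑ a, (K a : ℝ) * Real.logb 2 (K a) := by
    have : ∀ a, n * (if 0 < Pbar a then -(Pbar a * Real.logb 2 (Pbar a)) else 0)
        = (K a : ℝ) * Real.logb 2 n - (K a : ℝ) * Real.logb 2 (K a) := by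
      intro a
      rcases Nat.eq_zero_or_pos (K a) with h | h
      · simp [hP, h]
      · have h' : (0 : ℝ) < K a := by exact_mod_cast h
        have hp : 0 < Pbar a := by rw [hP]; positivity
        rw [if_pos hp]
        have : n * -(Pbar a * Real.logb 2 (Pbar a)) = -((n * Pbar a) * Real.logb 2 (Pbar a)) := by
          ring
        rw [this, hK, hP, Real.logb_div h'.ne' hn'.ne']
        ring
    unfold entH
    rw [Finset.mul_sum, Finset.sum_congr rfl fun a _ => this a, Finset.sum_sub_distrib,
      ← Finset.sum_mul]
    congr 2
    exact_mod_cast hsum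
  have hT0' : (0 : ℝ) < (typeClass n Pbar).card := by exact_mod_cast hT0
  have hlog := Real.logb_le_logb_of_le (b := 2) (by norm_num) (by positivity) main
  rw [Real.logb_mul (by positivity) (mul_ne_zero hT0'.ne' (Finset.prod_ne_zero_iff.2 fun a _ => hKK a)),
    Real.logb_mul hT0'.ne' (Finset.prod_ne_zero_iff.2 fun a _ => hKK a),
    Real.logb_prod _ _ (fun a _ => hKK a), Real.logb_pow, Real.logb_pow] at hlog
  simp only [Real.logb_pow] at hlog
  have hfl := Int.sub_one_lt_floor (Real.logb 2 ((typeClass n Pbar).card : ℝ))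
  have : entH Pbar
        - (Fintype.card α : ℝ) * Real.logb 2 ((n : ℝ) + Fintype.card α) / n
        - 1 / n = (n * entH Pbar
        - (Fintype.card α : ℝ) * Real.logb 2 ((n : ℝ) + Fintype.card α)
        - 1) / n := by
    field_simp
  rw [ge_iff_le, this, hent]
  gcongr
  linarith
end

section
/- Let α be a finite alphabet and let P be a probability distribution on α. Suppose that for each positive integer n, P̄_n is an n-type on α with supp(P̄_n) ⊆ supp(P) and D(P̄_n‖P) → 0 as n → ∞. Then the asymptotic rate of the constant composition distribution matcher satisfies (1/n)·⌊log₂|T^n(P̄_n)|⌋ → H(P) as n → ∞. -/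
open Filter Topology in
theorem aux_rem (C : ℝ) :
    Tendsto (fun n : ℕ => (C * (1 + Real.log ((n : ℝ) + 1)) / Real.log 2 + 1) / (n : ℝ))
      atTop (𝓝 0) := by
  have h1 : Tendsto (fun n : ℕ => Real.log ((n : ℝ) + 1) / ((n : ℝ))) atTop (𝓝 0) := by
    have hlog : Tendsto (fun x : ℝ => Real.log x / (1 * x + (-1))) atTop (𝓝 0) := by
      simpa using Real.tendsto_pow_log_div_mul_add_atTop 1 (-1) 1 one_ne_zero
    have h2 : Tendsto (fun n : ℕ => (n : ℝ) + 1) atTop atTop :=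
      tendsto_atTop_add_const_right _ _ tendsto_natCast_atTop_atTop
    refine (hlog.comp h2).congr fun n => ?_
    simp
  have h0 : Tendsto (fun n : ℕ => (1 : ℝ) / (n : ℝ)) atTop (𝓝 0) :=
    tendsto_one_div_atTop_nhds_zero_nat
  have h3 := ((h0.add h1).const_mul (C / Real.log 2)).add h0
  simp only [add_zero, mul_zero] at h3
  refine h3.congr fun n => ?_
  ring

theorem aux_fact_lower (n : ℕ) :
    (n : ℝ) * Real.log n - n ≤ Real.log (n.factorial : ℝ) := by
  induction n with
  | zero => simp
  | succ n ih =>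
    have hf : (n.factorial : ℝ) ≠ 0 := by exact_mod_cast n.factorial_ne_zero
    have hn1 : ((n : ℝ) + 1) ≠ 0 := by positivity
    rw [Nat.factorial_succ]
    push_cast
    rw [Real.log_mul hn1 hf]
    rcases Nat.eq_zero_or_pos n with rfl | hn
    · simp
    have hn0 : (0 : ℝ) < n := by exact_mod_cast hn
    have h := Real.log_le_sub_one_of_pos (show (0 : ℝ) < ((n : ℝ) + 1) / n by positivity)
    rw [Real.log_div hn1 hn0.ne'] at h
    have h2 : (n : ℝ) * (Real.log ((n : ℝ) + 1) - Real.log n) ≤ n * (((n : ℝ) + 1) / n - 1) :=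
      mul_le_mul_of_nonneg_left h hn0.le
    have h3 : (n : ℝ) * (((n : ℝ) + 1) / n - 1) = 1 := by field_simp; ring
    linarith

theorem aux_fact_upper (n : ℕ) :
    Real.log (n.factorial : ℝ) ≤ (n : ℝ) * Real.log n - n + (1 + Real.log n) := by
  induction n with
  | zero => simp
  | succ n ih =>
    have hf : (n.factorial : ℝ) ≠ 0 := by exact_mod_cast n.factorial_ne_zero
    have hn1 : (0 : ℝ) < ((n : ℝ) + 1) := by positivity
    rw [Nat.factorial_succ]
    push_cast
    rw [Real.log_mul hn1.ne' hf]
    rcases Nat.eq_zero_or_pos n with rfl | hn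
    · simp
    have hn0 : (0 : ℝ) < n := by exact_mod_cast hn
    have h := Real.log_le_sub_one_of_pos (show (0 : ℝ) < (n : ℝ) / ((n : ℝ) + 1) by positivity)
    rw [Real.log_div hn0.ne' hn1.ne'] at h
    have h2 := mul_le_mul_of_nonneg_left h hn1.le
    have h3 : ((n : ℝ) + 1) * ((n : ℝ) / ((n : ℝ) + 1) - 1) = -1 := by field_simp; ring
    linarith

theorem aux_card_s8 {α : Type*} [Fintype α] [DecidableEq α] (n : ℕ) (k : α → ℕ)
    (hk : ∑ a, k a = n) :
    n.factorial = (Finset.univ.filter fun c : Fin n → α => ∀ a, cnt c a = k a).card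
      * ∏ a, (k a).factorial := by
  have hcard : Fintype.card (Fin n) = Fintype.card (Σ a, Fin (k a)) := by simp [hk]
  let e := Fintype.equivOfCardEq hcard
  have hcnt : ∀ (c : Fin n → α) a, cnt c a = Fintype.card {i // c i = a} := by
    intro c a
    rw [Fintype.card_subtype]; rfl
  let c0 : Fin n → α := fun i => (e i).1
  have hc0 : ∀ a, cnt c0 a = k a := by
    intro a
    rw [hcnt, Fintype.card_congr (e.subtypeEquiv (q := fun x => x.1 = a) (fun i => Iff.rfl)),
      Fintype.card_congr (Equiv.sigmaSubtype (β := fun a => Fin (k a)) a)]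
    simp
  have hmap : ∀ g ∈ (Finset.univ : Finset (Equiv.Perm (Fin n))), c0 ∘ g ∈
      (Finset.univ.filter fun c : Fin n → α => ∀ a, cnt c a = k a) := by
    intro g _
    simp only [Finset.mem_filter, Finset.mem_univ, true_and]
    intro a
    rw [← hc0 a, hcnt, hcnt]
    exact Fintype.card_congr (g.subtypeEquiv (fun i => Iff.rfl))
  have hmain := Finset.card_eq_sum_card_fiberwise hmap
  rw [Finset.card_univ, Fintype.card_perm, Fintype.card_fin] at hmain
  rw [hmain]
  refine Finset.sum_const_nat ?_
  intro c hc
  simp only [Finset.mem_filter, Finset.mem_univ, true_and] at hc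
  have hex : ∀ a, Nonempty ({i // c i = a} ≃ {i // c0 i = a}) := by
    intro a
    refine Fintype.card_eq.1 ?_
    rw [← hcnt, ← hcnt, hc, hc0]
  let f := fun a => (hex a).some
  let h : Equiv.Perm (Fin n) :=
    (Equiv.sigmaFiberEquiv c).symm.trans ((Equiv.sigmaCongrRight f).trans (Equiv.sigmaFiberEquiv c0))
  have hh : ∀ i, c0 (h i) = c i := by
    intro i
    exact (f (c i) ⟨i, rfl⟩).2
  have hst := DomMulAct.stabilizer_card c0
  simp_rw [← hcnt, hc0] at hst
  rw [← hst, ← Fintype.card_subtype]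
  refine Fintype.card_congr ((Equiv.mulRight h⁻¹).subtypeEquiv fun g => ?_)
  constructor
  · intro hg
    funext i
    have h1 : c0 (g (h⁻¹ i)) = c (h⁻¹ i) := congrFun hg (h⁻¹ i)
    have h2 := hh (h⁻¹ i)
    rw [show h (h⁻¹ i) = i from h.apply_symm_apply i] at h2
    exact h1.trans h2.symm
  · intro hg
    funext i
    have h1 : c0 (g (h⁻¹ (h i))) = c0 (h i) := congrFun hg (h i)
    rw [show h⁻¹ (h i) = i from h.symm_apply_apply i, hh] at h1
    exact h1

theorem aux_hell {α : Type*} [Fintype α] (P Q : α → ℝ)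
    (hP0 : ∀ a, 0 ≤ P a) (hP1 : ∑ a, P a = 1) (hQ0 : ∀ a, 0 ≤ Q a) (hQ1 : ∑ a, Q a = 1)
    (hs : ∀ a, 0 < Q a → 0 < P a) (a : α) :
    (√(Q a) - √(P a)) ^ 2 ≤ divD Q P * Real.log 2 := by
  have hl : 0 < Real.log 2 := Real.log_pos one_lt_two
  have key : ∑ a, (√(Q a) - √(P a)) ^ 2 ≤ divD Q P * Real.log 2 := by
    have e1 : ∑ a, (√(Q a) - √(P a)) ^ 2 = ∑ a, (2 * Q a - 2 * (√(Q a) * √(P a))) := by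
      have : ∀ a, (√(Q a) - √(P a)) ^ 2
          = (2 * Q a - 2 * (√(Q a) * √(P a))) + (P a - Q a) := by
        intro a
        have h1 := Real.sq_sqrt (hQ0 a)
        have h2 := Real.sq_sqrt (hP0 a)
        linear_combination h1 + h2
      simp_rw [this]
      rw [Finset.sum_add_distrib, Finset.sum_sub_distrib P Q, hP1, hQ1]
      simp
    rw [e1, divD, Finset.sum_mul]
    refine Finset.sum_le_sum fun a _ => ?_
    split_ifs with h
    · have hp := hs a h
      have hq' := Real.sqrt_pos.2 h
      have hp' := Real.sqrt_pos.2 hp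
      have h1 := Real.log_le_sub_one_of_pos (div_pos hp' hq')
      rw [Real.log_div hp'.ne' hq'.ne', Real.log_sqrt hp.le, Real.log_sqrt h.le] at h1
      rw [Real.logb, mul_assoc, div_mul_cancel₀ _ hl.ne', Real.log_div h.ne' hp.ne']
      have h2 := mul_le_mul_of_nonneg_left h1 h.le
      have h3 : Q a * (√(P a) / √(Q a) - 1) = √(Q a) * √(P a) - Q a := by
        have := Real.sq_sqrt h.le
        field_simp
        linear_combination (-√(P a)) * this
      rw [h3] at h2
      linarith
    · have : Q a = 0 := le_antisymm (not_lt.1 h) (hQ0 a)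
      simp [this]
  exact (Finset.single_le_sum (f := fun a => (√(Q a) - √(P a)) ^ 2)
    (fun i _ => sq_nonneg _) (Finset.mem_univ a)).trans key

theorem aux_ent {α : Type*} [Fintype α] (Q : α → ℝ) (hQ0 : ∀ a, 0 ≤ Q a) :
    entH Q = (∑ a, Real.negMulLog (Q a)) / Real.log 2 := by
  rw [entH, Finset.sum_div]
  refine Finset.sum_congr rfl fun a _ => ?_
  split_ifs with h
  · rw [Real.negMulLog, Real.logb]; ring
  · have : Q a = 0 := le_antisymm (not_lt.1 h) (hQ0 a)
    simp [this]

theorem aux_bound {α : Type*} [Fintype α] [DecidableEq α] (n : ℕ) (hn : 0 < n) (Q : α → ℝ)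
    (hQ1 : ∑ a, Q a = 1) (hT : IsNType n Q) :
    |Real.log ((typeClass n Q).card : ℝ) - n * ∑ a, Real.negMulLog (Q a)|
      ≤ ((Fintype.card α : ℝ) + 1) * (1 + Real.log ((n : ℝ) + 1)) := by
  choose k hk using hT
  have hn0 : (0 : ℝ) < n := by exact_mod_cast hn
  have hQ : ∀ a, Q a = k a / n := fun a => by rw [← hk]; field_simp
  have hsumR : ∑ a, (k a : ℝ) = n := by
    simp_rw [← hk]; rw [← Finset.mul_sum, hQ1, mul_one]
  have hsum : ∑ a, k a = n := by exact_mod_cast hsumR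
  have hT : typeClass n Q = Finset.univ.filter fun c : Fin n → α => ∀ a, cnt c a = k a := by
    ext c
    simp only [typeClass, Finset.mem_filter, Finset.mem_univ, true_and]
    refine forall_congr' fun a => ?_
    rw [hQ, div_left_inj' hn0.ne']
    exact Nat.cast_inj
  have hc := aux_card_s8 n k hsum
  rw [← hT] at hc
  have hT0 : ((typeClass n Q).card : ℝ) ≠ 0 := by
    intro h
    have h' : (typeClass n Q).card = 0 := by exact_mod_cast h
    rw [h', zero_mul] at hc
    exact n.factorial_ne_zero hc
  have hlog : Real.log (n.factorial : ℝ)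
      = Real.log ((typeClass n Q).card : ℝ) + ∑ a, Real.log ((k a).factorial : ℝ) := by
    rw [hc]
    push_cast
    rw [Real.log_mul hT0 (Finset.prod_ne_zero_iff.2 fun a _ => by
      exact_mod_cast (k a).factorial_ne_zero), Real.log_prod (fun a _ => by
      exact_mod_cast (k a).factorial_ne_zero)]
  have hent : (n : ℝ) * ∑ a, Real.negMulLog (Q a)
      = n * Real.log n - ∑ a, (k a : ℝ) * Real.log (k a) := by
    have : ∀ a, (n : ℝ) * Real.negMulLog (Q a)
        = (k a : ℝ) * Real.log n - (k a : ℝ) * Real.log (k a) := by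
      intro a
      rw [Real.negMulLog, hQ]
      by_cases h : (k a : ℝ) = 0
      · simp [h]
      · rw [Real.log_div h hn0.ne']; field_simp; ring
    rw [Finset.mul_sum]
    simp_rw [this]
    rw [Finset.sum_sub_distrib, ← Finset.sum_mul, hsumR]
  have hlow : ∑ a, ((k a : ℝ) * Real.log (k a)) - n ≤ ∑ a, Real.log ((k a).factorial : ℝ) := by
    rw [← hsumR, ← Finset.sum_sub_distrib]
    exact Finset.sum_le_sum fun a _ => aux_fact_lower _
  have hup : ∑ a, Real.log ((k a).factorial : ℝ) ≤ ∑ a, ((k a : ℝ) * Real.log (k a)) - n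
      + (Fintype.card α : ℝ) * (1 + Real.log ((n : ℝ) + 1)) := by
    have : (Fintype.card α : ℝ) * (1 + Real.log ((n : ℝ) + 1))
        = ∑ _a : α, (1 + Real.log ((n : ℝ) + 1)) := by
      rw [Finset.sum_const, nsmul_eq_mul, Finset.card_univ]
    rw [this, ← hsumR, ← Finset.sum_sub_distrib, ← Finset.sum_add_distrib]
    refine Finset.sum_le_sum fun a _ => (aux_fact_upper _).trans ?_
    rw [hsumR]
    have hle : (k a : ℝ) ≤ n := by
      rw [← hsumR]
      exact Finset.single_le_sum (f := fun a => (k a : ℝ)) (fun _ _ => by positivity)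
        (Finset.mem_univ a)
    have : Real.log (k a) ≤ Real.log ((n : ℝ) + 1) := by
      rcases Nat.eq_zero_or_pos (k a) with h | h
      · rw [h]; simp only [Nat.cast_zero, Real.log_zero]
        exact Real.log_nonneg (by linarith)
      · exact Real.log_le_log (by exact_mod_cast h) (by linarith)
    linarith
  have h1 := aux_fact_lower n
  have h2 := aux_fact_upper n
  have h3 : Real.log (n : ℝ) ≤ Real.log ((n : ℝ) + 1) := Real.log_le_log hn0 (by linarith)
  have h4 : 0 ≤ Real.log ((n : ℝ) + 1) := Real.log_nonneg (by linarith)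
  have h5 : 0 ≤ (Fintype.card α : ℝ) * (1 + Real.log ((n : ℝ) + 1)) := by positivity
  rw [abs_le]
  constructor <;> linarith


/-- If `P̄_n` are `n`-types with `supp(P̄_n) ⊆ supp(P)` and `D(P̄_n‖P) → 0`, then the ccdm rate
`(1/n)·⌊log₂|T^n(P̄_n)|⌋` converges to `H(P)`. -/
theorem stmt8 {α : Type*} [Fintype α] [DecidableEq α] (P : α → ℝ)
    (hP0 : ∀ a, 0 ≤ P a) (hP1 : ∑ a, P a = 1)
    (Pbar : ℕ → α → ℝ)
    (hPbar : ∀ n : ℕ, 0 < n →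
      (∀ a, 0 ≤ Pbar n a) ∧ (∑ a, Pbar n a = 1) ∧ IsNType n (Pbar n) ∧
        (∀ a, 0 < Pbar n a → 0 < P a))
    (hD : Filter.Tendsto (fun n => divD (Pbar n) P) Filter.atTop (nhds 0)) :
    Filter.Tendsto
      (fun n => (⌊Real.logb 2 ((typeClass n (Pbar n)).card : ℝ)⌋ : ℝ) / n)
      Filter.atTop (nhds (entH P)) := by
  have hl : 0 < Real.log 2 := Real.log_pos one_lt_two
  -- pointwise convergence
  have hconv : ∀ a, Filter.Tendsto (fun n => Pbar n a) Filter.atTop (nhds (P a)) := by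
    intro a
    have h1 : Filter.Tendsto (fun n => (√(Pbar n a) - √(P a)) ^ 2) Filter.atTop (nhds 0) := by
      refine squeeze_zero' (Filter.Eventually.of_forall fun n => sq_nonneg _) ?_
        (by simpa using hD.mul_const (Real.log 2))
      filter_upwards [Filter.eventually_gt_atTop 0] with n hn
      obtain ⟨q0, q1, _, qs⟩ := hPbar n hn
      exact aux_hell P (Pbar n) hP0 hP1 q0 q1 qs a
    have h2 : Filter.Tendsto (fun n => |√(Pbar n a) - √(P a)|) Filter.atTop (nhds 0) := by
      have := h1.sqrt
      simpa [Real.sqrt_sq_eq_abs] using this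
    have h3 : Filter.Tendsto (fun n => √(Pbar n a)) Filter.atTop (nhds (√(P a))) := by
      rw [tendsto_iff_dist_tendsto_zero]
      simpa [Real.dist_eq] using h2
    have h4 := h3.pow 2
    rw [Real.sq_sqrt (hP0 a)] at h4
    refine h4.congr' ?_
    filter_upwards [Filter.eventually_gt_atTop 0] with n hn
    exact Real.sq_sqrt ((hPbar n hn).1 a)
  have hH : Filter.Tendsto (fun n => (∑ a, Real.negMulLog (Pbar n a)) / Real.log 2)
      Filter.atTop (nhds (entH P)) := by
    rw [aux_ent P hP0]
    refine Filter.Tendsto.div_const (tendsto_finsetSum _ fun a _ => ?_) _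
    exact (Real.continuous_negMulLog.tendsto _).comp (hconv a)
  have hdiff : Filter.Tendsto (fun n : ℕ =>
      (⌊Real.logb 2 ((typeClass n (Pbar n)).card : ℝ)⌋ : ℝ) / n
        - (∑ a, Real.negMulLog (Pbar n a)) / Real.log 2) Filter.atTop (nhds 0) := by
    refine squeeze_zero_norm' ?_ (aux_rem ((Fintype.card α : ℝ) + 1))
    filter_upwards [Filter.eventually_gt_atTop 0] with n hn
    obtain ⟨_, q1, qt, _⟩ := hPbar n hn
    have hn0 : (0 : ℝ) < n := by exact_mod_cast hn
    have hb := aux_bound n hn (Pbar n) q1 qt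
    set L := Real.log ((typeClass n (Pbar n)).card : ℝ) with hL
    set S := ∑ a, Real.negMulLog (Pbar n a) with hS
    rw [Real.logb, ← hL]
    have hf1 := Int.floor_le (L / Real.log 2)
    have hf2 := Int.lt_floor_add_one (L / Real.log 2)
    have e : (⌊L / Real.log 2⌋ : ℝ) / n - S / Real.log 2
        = ((⌊L / Real.log 2⌋ - L / Real.log 2) + (L - n * S) / Real.log 2) / n := by
      field_simp; ring
    rw [Real.norm_eq_abs, e, abs_div, abs_of_pos hn0]
    refine div_le_div_of_nonneg_right ((abs_add_le _ _).trans ?_) hn0.le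
    have g1 : |(⌊L / Real.log 2⌋ : ℝ) - L / Real.log 2| ≤ 1 := by
      rw [abs_le]; constructor <;> linarith
    have g2 : |(L - n * S) / Real.log 2|
        ≤ ((Fintype.card α : ℝ) + 1) * (1 + Real.log ((n : ℝ) + 1)) / Real.log 2 := by
      rw [abs_div, abs_of_pos hl]
      exact div_le_div_of_nonneg_right hb hl.le
    linarith
  have := hdiff.add hH
  simpa using this
end

section
/- Let α be a finite alphabet and let P be a probability distribution on α with full support. For each positive integer n, let P̄_n be an n-type on α with D(P̄_n‖P) → 0 as n → ∞, set m_n = ⌊log₂|T^n(P̄_n)|⌋, and let C_n be any subset of T^n(P̄_n) with |C_n| = 2^{m_n}. Let U_n be the uniform distribution on C_n, viewed as a distribution on α^n. Then the normalized informational divergence (1/n)·D(U_n‖P^n) → 0 as n → ∞. -/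
open Finset in
lemma aux_fact_card {α : Type*} [Fintype α] [DecidableEq α] (n : ℕ) (Q : α → ℝ)
    (c0 : Fin n → α) (h0 : c0 ∈ typeClass n Q) :
    n.factorial ≤ (typeClass n Q).card * ∏ a, (cnt c0 a).factorial := by
  classical
  have h1 : (univ : Finset (Equiv.Perm (Fin n))).card ≤
      (∏ a, (cnt c0 a).factorial) * (typeClass n Q).card := by
    apply Finset.card_le_mul_card_image_of_maps_to (f := fun g : Equiv.Perm (Fin n) => c0 ∘ g)
    · intro g _
      simp only [typeClass, mem_filter, mem_univ, true_and] at h0 ⊢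
      intro a
      rw [← h0 a]
      congr 2
      unfold cnt
      apply Finset.card_bij (fun i _ => g i)
      · intro i hi
        simpa using hi
      · intro i _ j _ h
        exact g.injective h
      · intro b hb
        exact ⟨g.symm b, by simpa using hb, by simp⟩
    · intro c hc
      have hs := DomMulAct.stabilizer_card c0
      have hs' : Fintype.card {g : Equiv.Perm (Fin n) // c0 ∘ g = c0} =
          ∏ a, (cnt c0 a).factorial := by
        rw [hs]
        refine Finset.prod_congr rfl fun a _ => ?_
        rw [Fintype.card_subtype]
        rfl
      rw [← hs', Fintype.card_subtype]
      rcases Finset.eq_empty_or_nonempty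
        (univ.filter fun g : Equiv.Perm (Fin n) => c0 ∘ g = c) with he | ⟨g0, hg0⟩
      · rw [he]; simp
      · apply Finset.card_le_card_of_injOn (fun g => g * g0⁻¹)
        · intro g hg
          simp only [mem_filter, mem_univ, true_and, coe_filter, Set.mem_ofPred_eq] at hg hg0 ⊢
          funext i
          have e1 := congrFun hg (g0⁻¹ i)
          have e2 := congrFun hg0 (g0⁻¹ i)
          have e3 : g0 (g0⁻¹ i) = i := g0.apply_symm_apply i
          simp only [Function.comp_apply, e3, Equiv.Perm.coe_mul] at e1 e2 ⊢
          rw [e1, e2]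
        · intro g _ g' _ h
          exact mul_right_cancel h
  rw [Finset.card_univ, Fintype.card_perm, Fintype.card_fin] at h1
  rwa [mul_comm]

lemma aux_log_fact_lower (n : ℕ) :
    (n : ℝ) * Real.log n - n ≤ Real.log (n.factorial) := by
  rcases Nat.eq_zero_or_pos n with rfl | hn
  · simp
  have hn' : (0 : ℝ) < n := by exact_mod_cast hn
  have h := Real.pow_div_factorial_le_exp (n : ℝ) hn'.le n
  have hf : (0 : ℝ) < n.factorial := by exact_mod_cast n.factorial_pos
  have h2 := Real.log_le_log (by positivity) h
  rw [Real.log_exp, Real.log_div (by positivity) (by positivity), Real.log_pow] at h2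
  linarith

lemma aux_log_fact_upper (n : ℕ) :
    Real.log (n.factorial) ≤ (n : ℝ) * Real.log n - n + 1 + Real.log n := by
  induction n with
  | zero => simp
  | succ k ih =>
    rcases Nat.eq_zero_or_pos k with rfl | hk
    · simp
    have hk' : (0 : ℝ) < k := by exact_mod_cast hk
    have hf : (0 : ℝ) < k.factorial := by exact_mod_cast k.factorial_pos
    rw [Nat.factorial_succ]
    push_cast
    rw [Real.log_mul (by positivity) (by positivity)]
    have h := Real.one_sub_inv_le_log_of_pos (show (0 : ℝ) < (k + 1) / k by positivity)
    rw [Real.log_div (by positivity) (by positivity)] at h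
    have h3 := mul_le_mul_of_nonneg_left h (show (0 : ℝ) ≤ k + 1 by positivity)
    have h4 : ((k : ℝ) + 1) * (1 - ((k + 1) / k : ℝ)⁻¹) = 1 := by
      field_simp
      ring
    rw [h4] at h3
    nlinarith

lemma aux_log_prodP {α : Type*} [Fintype α] [DecidableEq α] {n : ℕ} (P : α → ℝ)
    (hP0 : ∀ a, 0 < P a) (c : Fin n → α) :
    Real.log (prodP P c) = ∑ a, (cnt c a : ℝ) * Real.log (P a) := by
  unfold prodP cnt
  rw [Real.log_prod (fun i _ => (hP0 _).ne')]
  rw [Finset.sum_comp (fun a => Real.log (P a)) c]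
  simp only [nsmul_eq_mul]
  apply Finset.sum_subset (Finset.subset_univ _)
  intro a _ ha
  have : (Finset.univ.filter fun i => c i = a) = ∅ := by
    ext i
    simp only [Finset.mem_filter, Finset.mem_univ, true_and, Finset.notMem_empty, iff_false]
    intro h
    exact ha (by simp [← h])
  rw [this]; simp

lemma aux_sum_prodP {α : Type*} [Fintype α] [DecidableEq α] {n : ℕ} (P : α → ℝ)
    (hP1 : ∑ a, P a = 1) : ∑ c : Fin n → α, prodP P c = 1 := by
  unfold prodP
  rw [← Fintype.piFinset_univ, ← Finset.prod_univ_sum]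
  simp [hP1]

lemma aux_main_s9 {α : Type*} [Fintype α] [DecidableEq α] (P : α → ℝ)
    (hP0 : ∀ a, 0 < P a) (hP1 : ∑ a, P a = 1) (n : ℕ) (hn : 0 < n) (Q : α → ℝ)
    (hQ1 : ∑ a, Q a = 1)
    (C : Finset (Fin n → α)) (hCs : C ⊆ typeClass n Q)
    (hCc : C.card = 2 ^ Nat.log 2 (typeClass n Q).card) :
    0 ≤ divD (fun c => if c ∈ C then ((C.card : ℝ))⁻¹ else 0) (prodP P) ∧
    divD (fun c => if c ∈ C then ((C.card : ℝ))⁻¹ else 0) (prodP P) ≤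
      n * divD Q P + (Real.log 2 + Fintype.card α * (1 + Real.log n)) / Real.log 2 := by
  have hn' : (0 : ℝ) < n := by exact_mod_cast hn
  have hl2 : 0 < Real.log 2 := Real.log_pos (by norm_num)
  have hCpos : 0 < C.card := by rw [hCc]; positivity
  have hCpos' : (0 : ℝ) < C.card := by exact_mod_cast hCpos
  obtain ⟨c0, hc0⟩ := Finset.card_pos.mp hCpos
  have hk : ∀ c ∈ C, ∀ a, (cnt c a : ℝ) = n * Q a := by
    intro c hc a
    have := hCs hc
    simp only [typeClass, Finset.mem_filter, Finset.mem_univ, true_and] at this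
    rw [← this a]
    field_simp
  set L : ℝ := ∑ a, (cnt c0 a : ℝ) * Real.log (P a) with hL
  have hlp : ∀ c ∈ C, Real.log (prodP P c) = L := by
    intro c hc
    rw [aux_log_prodP P hP0, hL]
    refine Finset.sum_congr rfl fun a _ => ?_
    rw [hk c hc, hk c0 hc0]
  have hpp : ∀ c : Fin n → α, 0 < prodP P c := fun c => Finset.prod_pos fun i _ => hP0 _
  have hDU : divD (fun c => if c ∈ C then ((C.card : ℝ))⁻¹ else 0) (prodP P) =
      (- Real.log C.card - L) / Real.log 2 := by
    unfold divD
    rw [← Finset.sum_subset (Finset.subset_univ C)]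
    · rw [Finset.sum_congr rfl (g := fun _ => (C.card : ℝ)⁻¹ *
        ((- Real.log C.card - L) / Real.log 2))]
      · rw [Finset.sum_const, nsmul_eq_mul]
        field_simp
      · intro c hc
        simp only [if_pos hc]
        rw [if_pos (by positivity), Real.logb,
          Real.log_div (by positivity) (hpp c).ne', hlp c hc, Real.log_inv]
    · intro c _ hc
      simp [hc]
  rw [hDU]
  constructor
  · apply div_nonneg _ hl2.le
    have h1 : ∑ c ∈ C, prodP P c ≤ 1 := by
      rw [← aux_sum_prodP (n := n) P hP1]
      exact Finset.sum_le_sum_of_subset_of_nonneg (Finset.subset_univ _)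
        fun c _ _ => (hpp c).le
    rw [Finset.sum_congr rfl (g := fun _ => Real.exp L)
      (fun c hc => by rw [← hlp c hc, Real.exp_log (hpp c)]), Finset.sum_const,
      nsmul_eq_mul] at h1
    have h2 := Real.log_nonpos (by positivity) h1
    rw [Real.log_mul (by positivity) (Real.exp_pos _).ne', Real.log_exp] at h2
    linarith
  · have hsum : ∑ a, (cnt c0 a : ℝ) = n := by
      rw [Finset.sum_congr rfl (fun a _ => hk c0 hc0 a), ← Finset.mul_sum, hQ1, mul_one]
    have hDQ : n * divD Q P =
        (∑ a, (cnt c0 a : ℝ) * Real.log (cnt c0 a) - n * Real.log n - L) / Real.log 2 := by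
      have : (n : ℝ) * Real.log n = ∑ a, (cnt c0 a : ℝ) * Real.log n := by
        rw [← Finset.sum_mul, hsum]
      rw [this, hL, ← Finset.sum_sub_distrib, ← Finset.sum_sub_distrib, Finset.sum_div]
      unfold divD
      rw [Finset.mul_sum]
      refine Finset.sum_congr rfl fun a _ => ?_
      rw [hk c0 hc0 a]
      split_ifs with h
      · rw [Real.logb, Real.log_div h.ne' (hP0 a).ne', Real.log_mul hn'.ne' h.ne']
        ring
      · have h5 : (0 : ℝ) ≤ n * Q a := by rw [← hk c0 hc0 a]; positivity
        have h6 : Q a = 0 := le_antisymm (not_lt.mp h) (nonneg_of_mul_nonneg_right h5 hn')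
        simp [h6]
    rw [hDQ, ← add_div]
    apply div_le_div_of_nonneg_right _ hl2.le
    have hT := hCs hc0
    have hTpos : 0 < (typeClass n Q).card := Finset.card_pos.mpr ⟨c0, hT⟩
    have hTpos' : (0 : ℝ) < (typeClass n Q).card := by exact_mod_cast hTpos
    have hTC : Real.log (typeClass n Q).card ≤ Real.log 2 + Real.log C.card := by
      rw [← Real.log_mul (by norm_num) hCpos'.ne']
      apply Real.log_le_log hTpos'
      have := Nat.lt_pow_succ_log_self (b := 2) (by norm_num) (typeClass n Q).card
      rw [pow_succ, ← hCc, mul_comm] at this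
      exact_mod_cast this.le
    have hfc : Real.log n.factorial ≤ Real.log (typeClass n Q).card +
        ∑ a, Real.log (cnt c0 a).factorial := by
      have h7 : ∀ a, ((cnt c0 a).factorial : ℝ) ≠ 0 := fun a => by
        exact_mod_cast (cnt c0 a).factorial_ne_zero
      rw [← Real.log_prod (fun a _ => h7 a), ← Real.log_mul hTpos'.ne'
        (Finset.prod_ne_zero_iff.mpr fun a _ => h7 a)]
      apply Real.log_le_log (by exact_mod_cast n.factorial_pos)
      exact_mod_cast aux_fact_card n Q c0 hT
    have hlow := aux_log_fact_lower n
    have hup : ∑ a, Real.log (cnt c0 a).factorial ≤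
        ∑ a, ((cnt c0 a : ℝ) * Real.log (cnt c0 a) - cnt c0 a + (1 + Real.log n)) := by
      refine Finset.sum_le_sum fun a _ => ?_
      have h8 := aux_log_fact_upper (cnt c0 a)
      have h9 : Real.log (cnt c0 a) ≤ Real.log n := by
        rcases Nat.eq_zero_or_pos (cnt c0 a) with h | h
        · rw [h]; simpa using Real.log_natCast_nonneg n
        · apply Real.log_le_log (by exact_mod_cast h)
          rw [← hsum]
          exact Finset.single_le_sum (f := fun a => (cnt c0 a : ℝ))
            (fun _ _ => by positivity) (Finset.mem_univ a)
      linarith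
    rw [Finset.sum_add_distrib, Finset.sum_sub_distrib, hsum, Finset.sum_const,
      nsmul_eq_mul, Finset.card_univ] at hup
    linarith

/-- Asymptotic optimality of the ccdm: with `P` of full support, `n`-types `P̄_n` with
`D(P̄_n‖P) → 0`, `m_n = ⌊log₂|T^n(P̄_n)|⌋`, codebooks `C_n ⊆ T^n(P̄_n)` of size `2^{m_n}`, and
`U_n` uniform on `C_n`, the normalized divergence `(1/n)·D(U_n‖P^n)` tends to `0`.
(For a nonempty type class, `Nat.log 2` of its cardinality equals `⌊log₂|T^n(P̄_n)|⌋`.) -/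
theorem stmt9 {α : Type*} [Fintype α] [DecidableEq α] (P : α → ℝ)
    (hP0 : ∀ a, 0 < P a) (hP1 : ∑ a, P a = 1)
    (Pbar : ℕ → α → ℝ)
    (hPbar : ∀ n : ℕ, 0 < n →
      (∀ a, 0 ≤ Pbar n a) ∧ (∑ a, Pbar n a = 1) ∧ IsNType n (Pbar n))
    (hD : Filter.Tendsto (fun n => divD (Pbar n) P) Filter.atTop (nhds 0))
    (C : (n : ℕ) → Finset (Fin n → α))
    (hC : ∀ n : ℕ, 0 < n → C n ⊆ typeClass n (Pbar n) ∧
      (C n).card = 2 ^ Nat.log 2 (typeClass n (Pbar n)).card) :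
    Filter.Tendsto
      (fun n : ℕ => (1 / (n : ℝ)) *
        divD (fun c => if c ∈ C n then (((C n).card : ℝ))⁻¹ else 0) (prodP P))
      Filter.atTop (nhds 0) := by
  have hlog : Filter.Tendsto (fun n : ℕ => Real.log n / (n : ℝ)) Filter.atTop (nhds 0) :=
    (Real.isLittleO_log_id_atTop.tendsto_div_nhds_zero).comp tendsto_natCast_atTop_atTop
  have hinv : Filter.Tendsto (fun n : ℕ => ((n : ℝ))⁻¹) Filter.atTop (nhds 0) :=
    tendsto_inv_atTop_nhds_zero_nat
  have hup : Filter.Tendsto (fun n : ℕ => divD (Pbar n) P +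
      ((n : ℝ)⁻¹ * ((Real.log 2 + Fintype.card α) / Real.log 2) +
        Real.log n / (n : ℝ) * (Fintype.card α / Real.log 2))) Filter.atTop (nhds 0) := by
    simpa using hD.add ((hinv.mul_const ((Real.log 2 + Fintype.card α) / Real.log 2)).add
      (hlog.mul_const (Fintype.card α / Real.log 2)))
  refine tendsto_of_tendsto_of_tendsto_of_le_of_le' tendsto_const_nhds hup ?_ ?_
  · filter_upwards [Filter.eventually_gt_atTop 0] with n hn
    exact mul_nonneg (by positivity) (aux_main_s9 P hP0 hP1 n hn (Pbar n) (hPbar n hn).2.1 (C n)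
      (hC n hn).1 (hC n hn).2).1
  · filter_upwards [Filter.eventually_gt_atTop 0] with n hn
    have h := (aux_main_s9 P hP0 hP1 n hn (Pbar n) (hPbar n hn).2.1 (C n)
      (hC n hn).1 (hC n hn).2).2
    have hn' : (0 : ℝ) < n := by exact_mod_cast hn
    have hl2 : 0 < Real.log 2 := Real.log_pos (by norm_num)
    refine (mul_le_mul_of_nonneg_left h (by positivity)).trans (le_of_eq ?_)
    field_simp
    ring
end

section
/- (Achievability of the maximum matching rate) Let α be a finite alphabet and let P be a probability distribution on α with full support. For every ε > 0 there exists N such that for every n ≥ N there exist a natural number m and an injective map f : {0,1}^m → α^n such that, denoting by U the uniform distribution on the image f({0,1}^m) viewed as a distribution on α^n, both (1/n)·D(U‖P^n) ≤ ε and m/n ≥ H(P) − ε hold. -/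
lemma moments_aux {α : Type*} [Fintype α] (P g : α → ℝ)
    (hP1 : ∑ a, P a = 1) (hg : ∑ a, P a * g a = 0) (n : ℕ) :
    (∑ c : Fin n → α, prodP P c = 1) ∧ (∑ c : Fin n → α, prodP P c * ∑ i, g (c i) = 0) ∧
    (∑ c : Fin n → α, prodP P c * (∑ i, g (c i)) ^ 2 = n * ∑ a, P a * g a ^ 2) := by
  induction n with
  | zero => simp [prodP]
  | succ n ih =>
    obtain ⟨h0, h1, h2⟩ := ih
    have key : ∀ F : (Fin (n+1) → α) → ℝ,
        ∑ c, F c = ∑ a, ∑ c : Fin n → α, F (Fin.cons a c) := by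
      intro F
      rw [← Equiv.sum_comp (Fin.consEquiv (fun _ => α)) F, Fintype.sum_prod_type]
      rfl
    have hp : ∀ (a : α) (c : Fin n → α),
        prodP P (Fin.cons a c : Fin (n+1) → α) = P a * prodP P c := by
      intro a c
      simp [prodP, Fin.prod_univ_succ]
    have hs : ∀ (a : α) (c : Fin n → α),
        ∑ i, g ((Fin.cons a c : Fin (n+1) → α) i) = g a + ∑ i, g (c i) := by
      intro a c
      simp [Fin.sum_univ_succ]
    refine ⟨?_, ?_, ?_⟩
    · rw [key]
      simp only [hp, ← Finset.mul_sum, h0, mul_one, hP1]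
    · rw [key]
      simp only [hp, hs]
      have : ∀ a, ∑ c : Fin n → α, P a * prodP P c * (g a + ∑ i, g (c i)) = P a * g a := by
        intro a
        calc _ = P a * g a * ∑ c : Fin n → α, prodP P c
              + P a * ∑ c : Fin n → α, prodP P c * ∑ i, g (c i) := by
              rw [Finset.mul_sum, Finset.mul_sum, ← Finset.sum_add_distrib]
              exact Finset.sum_congr rfl fun c _ => by ring
          _ = _ := by rw [h0, h1]; ring
      simp only [this, hg]
    · rw [key]
      simp only [hp, hs]
      have : ∀ a, ∑ c : Fin n → α, P a * prodP P c * (g a + ∑ i, g (c i)) ^ 2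
          = P a * g a ^ 2 + P a * (n * ∑ a, P a * g a ^ 2) := by
        intro a
        calc _ = P a * g a ^ 2 * ∑ c : Fin n → α, prodP P c
              + 2 * P a * g a * ∑ c : Fin n → α, prodP P c * ∑ i, g (c i)
              + P a * ∑ c : Fin n → α, prodP P c * (∑ i, g (c i)) ^ 2 := by
              rw [Finset.mul_sum, Finset.mul_sum, Finset.mul_sum, ← Finset.sum_add_distrib,
                ← Finset.sum_add_distrib]
              exact Finset.sum_congr rfl fun c _ => by ring
          _ = _ := by rw [h0, h1, h2]; ring
      simp only [this, Finset.sum_add_distrib, ← Finset.sum_mul, hP1]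
      push_cast
      ring

/-- Achievability of the maximum matching rate: for full-support `P` and every `ε > 0`, for all
sufficiently large `n` there is an injective f2f matcher `f : {0,1}^m → α^n` whose uniform
output distribution `U` satisfies `(1/n)·D(U‖P^n) ≤ ε` and whose rate satisfies
`m/n ≥ H(P) − ε`. -/
theorem stmt10 {α : Type*} [Fintype α] [DecidableEq α] (P : α → ℝ)
    (hP0 : ∀ a, 0 < P a) (hP1 : ∑ a, P a = 1) :
    ∀ ε > (0 : ℝ), ∃ N : ℕ, ∀ n ≥ N, ∃ (m : ℕ) (f : (Fin m → Bool) → (Fin n → α)),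
      Function.Injective f ∧
      (1 / (n : ℝ)) *
        divD (fun c => if c ∈ Finset.univ.image f then ((2 : ℝ) ^ m)⁻¹ else 0)
          (prodP P) ≤ ε ∧
      (m : ℝ) / n ≥ entH P - ε := by
  intro ε hε
  set H := entH P with hH
  have hHe : H = ∑ a, -(P a * Real.logb 2 (P a)) := by
    rw [hH]; unfold entH
    exact Finset.sum_congr rfl fun a _ => by rw [if_pos (hP0 a)]
  set g : α → ℝ := fun a => -Real.logb 2 (P a) - H with hgdef
  have hg : ∑ a, P a * g a = 0 := by
    have : ∀ a, P a * g a = -(P a * Real.logb 2 (P a)) - P a * H := fun a => by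
      simp only [hgdef]; ring
    simp only [this, Finset.sum_sub_distrib, ← Finset.sum_mul, hP1]
    rw [← hHe]; ring
  set V := ∑ a, P a * g a ^ 2 with hV
  obtain ⟨δ, hδ⟩ : ∃ δ, δ = ε / 4 := ⟨_, rfl⟩
  have hδ0 : 0 < δ := by rw [hδ]; positivity
  obtain ⟨N, hN⟩ := exists_nat_gt (max (4 / ε) (2 * V / δ ^ 2))
  refine ⟨N, fun n hn => ?_⟩
  have hnN : (N : ℝ) ≤ n := by exact_mod_cast hn
  have hn1 : 4 / ε < n := lt_of_lt_of_le (lt_of_le_of_lt (le_max_left _ _) hN) hnN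
  have hn2 : 2 * V / δ ^ 2 < n := lt_of_lt_of_le (lt_of_le_of_lt (le_max_right _ _) hN) hnN
  have hn0 : (0 : ℝ) < n := lt_trans (by positivity) hn1
  have hn1' : 4 < n * ε := by rwa [div_lt_iff₀ hε] at hn1
  have hn2' : 2 * V < n * δ ^ 2 := by rwa [div_lt_iff₀ (by positivity)] at hn2
  obtain ⟨h0, -, h2⟩ := moments_aux P g hP1 hg n
  have hpos : ∀ c : Fin n → α, 0 < prodP P c := fun c => Finset.prod_pos fun i _ => hP0 _
  have hS : ∀ c : Fin n → α, ∑ i, g (c i) = -Real.logb 2 (prodP P c) - n * H := by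
    intro c
    unfold prodP
    rw [Real.logb_prod _ _ (fun i _ => (hP0 _).ne')]
    simp [hgdef, Finset.sum_sub_distrib]
  set T : Finset (Fin n → α) := Finset.univ.filter fun c => |∑ i, g (c i)| ≤ n * δ with hT
  have hTmem : ∀ c, c ∈ T ↔ |∑ i, g (c i)| ≤ n * δ := fun c => by simp [hT]
  have hnd : 0 < n * δ := by positivity
  -- Chebyshev
  have hcheb : (n * δ) ^ 2 * ∑ c ∈ Tᶜ, prodP P c ≤ n * V := by
    rw [← h2, Finset.mul_sum]
    calc _ ≤ ∑ c ∈ Tᶜ, prodP P c * (∑ i, g (c i)) ^ 2 := by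
          refine Finset.sum_le_sum fun c hc => ?_
          rw [Finset.mem_compl, hTmem, not_le] at hc
          rw [mul_comm]
          refine mul_le_mul_of_nonneg_left ?_ (hpos c).le
          rw [← sq_abs (∑ i, g (c i))]
          exact pow_le_pow_left₀ hnd.le hc.le 2
      _ ≤ _ := Finset.sum_le_sum_of_subset_of_nonneg (Finset.subset_univ _)
          fun c _ _ => mul_nonneg (hpos c).le (sq_nonneg _)
  have hhalf : (1 : ℝ) / 2 ≤ ∑ c ∈ T, prodP P c := by
    have hsum := Finset.sum_add_sum_compl T (fun c => prodP P c)
    rw [h0] at hsum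
    by_contra hlt
    push Not at hlt
    have h3 : 1 / 2 < ∑ c ∈ Tᶜ, prodP P c := by linarith
    have h4 := mul_lt_mul_of_pos_left h3 (show 0 < (n * δ) ^ 2 by positivity)
    have h5 := mul_lt_mul_of_pos_left hn2' hn0
    nlinarith
  have hup : ∀ c ∈ T, prodP P c ≤ (2 : ℝ) ^ (-(n * (H - δ))) := by
    intro c hc
    rw [hTmem, hS, abs_le] at hc
    rw [← Real.logb_le_iff_le_rpow (by norm_num) (hpos c)]
    linarith [hc.1]
  have hcard : (1 : ℝ) / 2 ≤ T.card * (2 : ℝ) ^ (-(n * (H - δ))) := by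
    refine hhalf.trans ((Finset.sum_le_sum hup).trans ?_)
    simp
  have hTne : T.card ≠ 0 := by
    intro h
    rw [h] at hcard
    norm_num at hcard
  set m := Nat.log 2 T.card with hm
  have hm1 : 2 ^ m ≤ T.card := Nat.pow_log_le_self 2 hTne
  have hm2 : T.card < 2 ^ (m + 1) := Nat.lt_pow_succ_log_self (by norm_num) _
  have hmR : n * (H - δ) - 2 ≤ m := by
    have h6 : (T.card : ℝ) ≤ (2 : ℝ) ^ ((m : ℝ) + 1) := by
      have : (T.card : ℝ) ≤ (2 : ℝ) ^ (m + 1) := by exact_mod_cast hm2.le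
      rw [← Real.rpow_natCast] at this
      simpa using this
    have h7 : (2 : ℝ) ^ (-1 : ℝ) ≤ (2 : ℝ) ^ ((m : ℝ) + 1 + -(n * (H - δ))) := by
      rw [Real.rpow_add (by norm_num), Real.rpow_neg_one]
      have := hcard.trans (mul_le_mul_of_nonneg_right h6 (by positivity))
      norm_num at this ⊢
      exact this
    rw [Real.rpow_le_rpow_left_iff (by norm_num)] at h7
    linarith
  obtain ⟨e⟩ : Nonempty ((Fin m → Bool) ↪ T) :=
    Function.Embedding.nonempty_of_card_le (by simpa using hm1)
  have hinj : Function.Injective (fun x => (e x : Fin n → α)) :=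
    Subtype.val_injective.comp e.injective
  refine ⟨m, fun x => (e x : Fin n → α), hinj, ?_, ?_⟩
  · set I := Finset.univ.image (fun x => (e x : Fin n → α)) with hI
    have hIT : ∀ c ∈ I, c ∈ T := by
      intro c hc
      rw [hI, Finset.mem_image] at hc
      obtain ⟨x, -, rfl⟩ := hc
      exact (e x).2
    have hIc : (I.card : ℝ) = 2 ^ m := by
      rw [hI, Finset.card_image_of_injective _ hinj]; simp
    have hpm : (0 : ℝ) < 2 ^ m := by positivity
    have hD : divD (fun c => if c ∈ I then ((2 : ℝ) ^ m)⁻¹ else 0) (prodP P)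
        ≤ 2 * (n * δ) + 2 := by
      unfold divD
      calc _ ≤ ∑ c : Fin n → α, if c ∈ I then ((2 : ℝ) ^ m)⁻¹ * (2 * (n * δ) + 2) else 0 := by
            refine Finset.sum_le_sum fun c _ => ?_
            by_cases hc : c ∈ I
            · simp only [hc, if_true]
              rw [if_pos (by positivity)]
              refine mul_le_mul_of_nonneg_left ?_ (by positivity)
              rw [Real.logb_div (by positivity) (hpos c).ne', Real.logb_inv, Real.logb_pow,
                Real.logb_self_eq_one (by norm_num)]
              have h8 := (hTmem c).1 (hIT c hc)
              rw [hS, abs_le] at h8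
              linarith [h8.2]
            · simp [hc]
        _ = _ := by
            rw [Finset.sum_ite_mem, Finset.univ_inter, Finset.sum_const, nsmul_eq_mul, hIc]
            field_simp
    rw [one_div, inv_mul_le_iff₀ hn0]
    refine hD.trans ?_
    rw [hδ]; linarith
  · rw [ge_iff_le, le_div_iff₀ hn0]
    rw [hδ] at hmR
    linarith
end

section
/- (Converse) Let α be a finite alphabet and let P be a probability distribution on α. For every ε > 0 there exists δ > 0 such that for all positive integers n and m and every injective map f : {0,1}^m → α^n whose image is contained in supp(P)^n, if the uniform distribution U on the image f({0,1}^m) satisfies (1/n)·D(U‖P^n) ≤ δ, then m/n ≤ H(P) + ε. -/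
/-- Tilted weights. -/
noncomputable def tiltW {α : Type*} (P : α → ℝ) (s : ℝ) (a : α) : ℝ :=
  if 0 < P a then P a ^ s else 0

lemma tiltW_nonneg {α : Type*} (P : α → ℝ) (s : ℝ) (a : α) : 0 ≤ tiltW P s a := by
  unfold tiltW
  split_ifs with h
  · exact (Real.rpow_pos_of_pos h s).le
  · exact le_rfl

lemma tiltW_sum_one {α : Type*} [Fintype α] (P : α → ℝ)
    (hP0 : ∀ a, 0 ≤ P a) (hP1 : ∑ a, P a = 1) : ∑ a, tiltW P 1 a = 1 := by
  refine Eq.trans (Finset.sum_congr rfl fun a _ => ?_) hP1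
  unfold tiltW
  split_ifs with h
  · simp
  · exact le_antisymm (hP0 a) (not_lt.mp h)

lemma exists_tilt {α : Type*} [Fintype α] (P : α → ℝ)
    (hP0 : ∀ a, 0 ≤ P a) (hP1 : ∑ a, P a = 1) (ε : ℝ) (hε : 0 < ε) :
    ∃ s : ℝ, 0 < s ∧ s < 1 ∧
      Real.log (∑ a, tiltW P s a) ≤ (1 - s) * ((entH P + ε) * Real.log 2) := by
  have hl2 : 0 < Real.log 2 := Real.log_pos one_lt_two
  have hone := tiltW_sum_one P hP0 hP1
  have hd : HasDerivAt (fun s => ∑ a, tiltW P s a) (-(entH P * Real.log 2)) 1 := by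
    have h1 : HasDerivAt (fun s => ∑ a, tiltW P s a)
        (∑ a, if 0 < P a then P a * Real.log (P a) else 0) 1 := by
      refine HasDerivAt.fun_sum fun a _ => ?_
      unfold tiltW
      split_ifs with h
      · have := (hasDerivAt_id (1:ℝ)).const_rpow h
        simpa [mul_comm] using this
      · exact hasDerivAt_const _ _
    convert h1 using 1
    unfold entH
    rw [Finset.sum_mul, ← Finset.sum_neg_distrib]
    refine Finset.sum_congr rfl fun a _ => ?_
    split_ifs with h
    · unfold Real.logb
      field_simp
    · simp
  have hlog := hd.log (by rw [hone]; exact one_ne_zero)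
  rw [hone, div_one] at hlog
  have ht := hlog.hasDerivWithinAt (s := Set.Iio 1)
  rw [hasDerivWithinAt_iff_tendsto_slope' (by simp)] at ht
  have hev := ht.eventually (lt_mem_nhds (show -((entH P + ε) * Real.log 2) <
    -(entH P * Real.log 2) by nlinarith))
  have h01 : ∀ᶠ s in nhdsWithin (1:ℝ) (Set.Iio 1), s ∈ Set.Ioo (0:ℝ) 1 :=
    Ioo_mem_nhdsLT one_pos
  obtain ⟨s, hs, hs01⟩ := (hev.and h01).exists
  refine ⟨s, hs01.1, hs01.2, ?_⟩
  rw [slope_def_field, hone, Real.log_one, sub_zero,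
    lt_div_iff_of_neg (by linarith [hs01.2])] at hs
  linarith

lemma gibbs_aux {α : Type*} [Fintype α] [DecidableEq α] (P : α → ℝ) (s : ℝ)
    (n m : ℕ) (f : (Fin m → Bool) → (Fin n → α)) (hf : Function.Injective f)
    (hpos : ∀ b i, 0 < P (f b i)) (hZ : 0 < ∑ a, tiltW P s a) :
    s * (∑ b, ((2:ℝ)^m)⁻¹ * Real.log (prodP P (f b))) + m * Real.log 2 ≤
      n * Real.log (∑ a, tiltW P s a) := by
  set Z := ∑ a, tiltW P s a with hZd
  have h2 : (0:ℝ) < 2^m := by positivity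
  have hq : ∀ b, Real.log ((∏ i, tiltW P s (f b i)) / Z^n * 2^m) =
      s * Real.log (prodP P (f b)) - n * Real.log Z + m * Real.log 2 := by
    intro b
    have hpp : 0 < prodP P (f b) := Finset.prod_pos fun i _ => hpos b i
    have he : ∏ i, tiltW P s (f b i) = prodP P (f b) ^ s := by
      unfold prodP tiltW
      rw [← Real.finsetProd_rpow _ _ (fun i _ => (hpos b i).le)]
      exact Finset.prod_congr rfl fun i _ => if_pos (hpos b i)
    have hp2 : 0 < prodP P (f b) ^ s := Real.rpow_pos_of_pos hpp s
    rw [he, Real.log_mul (by positivity) h2.ne', Real.log_div hp2.ne' (by positivity),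
      Real.log_rpow hpp, Real.log_pow, Real.log_pow]
  have hcard : ∑ _b : Fin m → Bool, ((2:ℝ)^m)⁻¹ = 1 := by
    simp
  have hsum : ∑ b, ((2:ℝ)^m)⁻¹ * Real.log ((∏ i, tiltW P s (f b i)) / Z^n * 2^m) ≤ 0 := by
    calc _ ≤ ∑ b, ((∏ i, tiltW P s (f b i)) / Z^n - ((2:ℝ)^m)⁻¹) := by
          refine Finset.sum_le_sum fun b _ => ?_
          have hp : 0 < ∏ i, tiltW P s (f b i) := Finset.prod_pos fun i _ => by
            unfold tiltW
            rw [if_pos (hpos b i)]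
            exact Real.rpow_pos_of_pos (hpos b i) s
          have := Real.log_le_sub_one_of_pos
            (show 0 < (∏ i, tiltW P s (f b i)) / Z^n * 2^m by positivity)
          calc _ ≤ ((2:ℝ)^m)⁻¹ * ((∏ i, tiltW P s (f b i)) / Z^n * 2^m - 1) := by gcongr
            _ = _ := by field_simp
      _ = (∑ b, ∏ i, tiltW P s (f b i)) / Z^n - 1 := by
          rw [Finset.sum_sub_distrib, hcard, Finset.sum_div]
      _ ≤ 0 := by
          rw [sub_nonpos, div_le_one (by positivity)]
          have hpw : Z^n = ∑ c : Fin n → α, ∏ i, tiltW P s (c i) := by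
            rw [hZd, Fintype.sum_pow]
          rw [hpw, ← Finset.sum_image (s := Finset.univ) (g := f)
            (f := fun c => ∏ i, tiltW P s (c i)) (fun x _ y _ h => hf h)]
          exact Finset.sum_le_sum_of_subset_of_nonneg (Finset.subset_univ _)
            fun c _ _ => Finset.prod_nonneg fun i _ => tiltW_nonneg P s _
  have hexp : ∑ b, ((2:ℝ)^m)⁻¹ * Real.log ((∏ i, tiltW P s (f b i)) / Z^n * 2^m) =
      s * (∑ b, ((2:ℝ)^m)⁻¹ * Real.log (prodP P (f b))) +
        (∑ _b : Fin m → Bool, ((2:ℝ)^m)⁻¹) * (- (n * Real.log Z) + m * Real.log 2) := by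
    rw [Finset.mul_sum, Finset.sum_mul, ← Finset.sum_add_distrib]
    refine Finset.sum_congr rfl fun b _ => ?_
    rw [hq]
    ring
  rw [hexp, hcard] at hsum
  linarith

lemma divD_eq {α : Type*} [Fintype α] [DecidableEq α] (P : α → ℝ)
    (n m : ℕ) (f : (Fin m → Bool) → (Fin n → α)) (hf : Function.Injective f)
    (hpos : ∀ b i, 0 < P (f b i)) :
    divD (fun c => if c ∈ Finset.univ.image f then ((2 : ℝ) ^ m)⁻¹ else 0) (prodP P)
      * Real.log 2 =
    - (m * Real.log 2) - ∑ b, ((2:ℝ)^m)⁻¹ * Real.log (prodP P (f b)) := by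
  have hl2 : 0 < Real.log 2 := Real.log_pos one_lt_two
  have h2 : (0:ℝ) < (2^m)⁻¹ := by positivity
  have hcard : ∑ _b : Fin m → Bool, ((2:ℝ)^m)⁻¹ = 1 := by
    simp
  have h1 : divD (fun c => if c ∈ Finset.univ.image f then ((2 : ℝ) ^ m)⁻¹ else 0) (prodP P)
      = ∑ c ∈ Finset.univ.image f,
        ((2:ℝ)^m)⁻¹ * Real.logb 2 (((2:ℝ)^m)⁻¹ / prodP P c) := by
    unfold divD
    rw [← Finset.sum_subset (Finset.subset_univ (Finset.univ.image f))]
    · refine Finset.sum_congr rfl fun c hc => ?_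
      simp only [if_pos hc, if_pos h2]
    · intro c _ hc
      simp only [if_neg hc, lt_irrefl, if_false]
  rw [h1, Finset.sum_image (fun x _ y _ h => hf h), Finset.sum_mul]
  have h3 : -((m:ℝ) * Real.log 2) =
      ∑ _b : Fin m → Bool, ((2:ℝ)^m)⁻¹ * -((m:ℝ) * Real.log 2) := by
    rw [← Finset.sum_mul, hcard, one_mul]
  rw [h3, ← Finset.sum_sub_distrib]
  refine Finset.sum_congr rfl fun b _ => ?_
  have hpp : 0 < prodP P (f b) := Finset.prod_pos fun i _ => hpos b i
  unfold Real.logb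
  rw [Real.log_div h2.ne' hpp.ne', Real.log_inv, Real.log_pow]
  field_simp

/-- Converse: for every `ε > 0` there is a `δ > 0` such that any injective f2f matcher
`f : {0,1}^m → α^n` with image inside `supp(P)^n` whose uniform output distribution `U`
satisfies `(1/n)·D(U‖P^n) ≤ δ` has rate `m/n ≤ H(P) + ε`. -/
theorem stmt11 {α : Type*} [Fintype α] [DecidableEq α] (P : α → ℝ)
    (hP0 : ∀ a, 0 ≤ P a) (hP1 : ∑ a, P a = 1) :
    ∀ ε > (0 : ℝ), ∃ δ > (0 : ℝ), ∀ (n m : ℕ), 0 < n →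
      ∀ f : (Fin m → Bool) → (Fin n → α), Function.Injective f →
      (∀ b i, 0 < P (f b i)) →
      (1 / (n : ℝ)) *
        divD (fun c => if c ∈ Finset.univ.image f then ((2 : ℝ) ^ m)⁻¹ else 0)
          (prodP P) ≤ δ →
      (m : ℝ) / n ≤ entH P + ε := by
  intro ε hε
  have hl2 : 0 < Real.log 2 := Real.log_pos one_lt_two
  obtain ⟨s, hs0, hs1, hs⟩ := exists_tilt P hP0 hP1 (ε / 2) (by linarith)
  refine ⟨(1 - s) * (ε / 2), mul_pos (by linarith) (by linarith), ?_⟩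
  intro n m hn f hf hpos hD
  have hn' : (0:ℝ) < n := by exact_mod_cast hn
  have hZ : 0 < ∑ a, tiltW P s a := by
    let b : Fin m → Bool := fun _ => true
    refine Finset.sum_pos' (fun a _ => tiltW_nonneg P s a)
      ⟨f b ⟨0, hn⟩, Finset.mem_univ _, ?_⟩
    unfold tiltW
    rw [if_pos (hpos _ _)]
    exact Real.rpow_pos_of_pos (hpos _ _) s
  have hG := gibbs_aux P s n m f hf hpos hZ
  have hE := divD_eq P n m f hf hpos
  set D := divD (fun c => if c ∈ Finset.univ.image f then ((2 : ℝ) ^ m)⁻¹ else 0) (prodP P)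
  set A := ∑ b, ((2:ℝ)^m)⁻¹ * Real.log (prodP P (f b))
  have hD' : D ≤ n * ((1 - s) * (ε / 2)) := by
    rw [one_div, inv_mul_le_iff₀ hn'] at hD
    exact hD
  have hA : A = -(m * Real.log 2) - D * Real.log 2 := by linarith
  rw [hA] at hG
  have k1 : (n:ℝ) * Real.log (∑ a, tiltW P s a) ≤
      n * ((1 - s) * ((entH P + ε / 2) * Real.log 2)) := by gcongr
  have k2 : s * D ≤ n * ((1 - s) * (ε / 2)) := by
    have hn0 : 0 ≤ n * ((1 - s) * (ε / 2)) :=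
      mul_nonneg hn'.le (mul_nonneg (by linarith) (by linarith))
    calc s * D ≤ s * (n * ((1 - s) * (ε / 2))) := by gcongr
      _ ≤ 1 * (n * ((1 - s) * (ε / 2))) := by gcongr
      _ = _ := one_mul _
  have k3 := mul_le_mul_of_nonneg_right k2 hl2.le
  have k4 : ((1 - s) * Real.log 2) * m ≤ ((1 - s) * Real.log 2) * ((entH P + ε) * n) := by
    nlinarith
  rw [div_le_iff₀ hn']
  exact le_of_mul_le_mul_left k4 (mul_pos (by linarith) hl2)
end
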